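/- For every ε > 0 and δ > 0 there exists N such that for all n ≥ N and all integers ℓ ≥ (1+ε)n, the proportion of ℓ-lifts of K_n whose Hajós number equals exactly n is at least 1 − δ. -/

import Mathlib

/-- The `ℓ`-lift of the complete graph `K_n` determined by a family of permutations
`σ` (only the values `σ i j` for `i < j` matter): vertices `(i,a)` and `(j, σ i j a)`
are adjacent for `i < j`. -/
def liftGraph (n ℓ : ℕ) (σ : Fin n → Fin n → Equiv.Perm (Fin ℓ)) :
    SimpleGraph (Fin n × Fin ℓ) :=
  SimpleGraph.fromRel (fun x y => x.1 < y.1 ∧ σ x.1 y.1 x.2 = y.2)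

/-- The proportion of `ℓ`-lifts of `K_n` (all chosen uniformly at random) whose lift
graph satisfies the property `p`. -/
noncomputable def liftProb (n ℓ : ℕ) (p : SimpleGraph (Fin n × Fin ℓ) → Prop) : ℝ :=
  ((@Finset.filter _ (fun σ : Fin n → Fin n → Equiv.Perm (Fin ℓ) => p (liftGraph n ℓ σ))
      (Classical.decPred _) Finset.univ).card : ℝ)
    / (Fintype.card (Fin n → Fin n → Equiv.Perm (Fin ℓ)) : ℝ)

/-- `f : Fin m → V` is the family of branch vertices of a topological clique of order `m`
in `G`: `f` is injective and there are pairwise internally vertex-disjoint paths between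
the branch vertices whose internal vertices avoid all branch vertices. -/
def HasTopCliqueFun {V : Type*} (G : SimpleGraph V) {m : ℕ} (f : Fin m → V) : Prop :=
  Function.Injective f ∧
  ∃ P : ∀ i j : Fin m, G.Walk (f i) (f j),
    (∀ i j : Fin m, i < j → (P i j).IsPath) ∧
    (∀ i j : Fin m, i < j → ∀ k : Fin m, f k ∉ (P i j).support.tail.dropLast) ∧
    (∀ i j i' j' : Fin m, i < j → i' < j' → (i, j) ≠ (i', j') →
      ∀ x, x ∈ (P i j).support.tail.dropLast → x ∉ (P i' j').support.tail.dropLast)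

/-- `G` contains a topological clique of order `m` (a subdivision of `K_m`). -/
def HasTopClique {V : Type*} (G : SimpleGraph V) (m : ℕ) : Prop :=
  ∃ f : Fin m → V, HasTopCliqueFun G f

/-- The Hajós number of `G`: the largest order of a topological clique in `G`. -/
noncomputable def hajosNumber {V : Type*} [Fintype V] (G : SimpleGraph V) : ℕ :=
  sSup {m | HasTopClique G m}

/-! ### Linking prescribed pairs in an expanding graph -/

section Linking

variable {V : Type*}

open scoped Classical in
/-- The vertices of `F` with a neighbour in `U`. -/
noncomputable def nbhd (G : SimpleGraph V) (U F : Finset V) : Finset V :=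
  F.filter fun y => ∃ x ∈ U, G.Adj x y

lemma mem_nbhd {G : SimpleGraph V} {U F : Finset V} {y : V} :
    y ∈ nbhd G U F ↔ y ∈ F ∧ ∃ x ∈ U, G.Adj x y := by
  simp [nbhd]

variable [DecidableEq V]

lemma nbhd_union (G : SimpleGraph V) (U₁ U₂ F : Finset V) :
    nbhd G (U₁ ∪ U₂) F = nbhd G U₁ F ∪ nbhd G U₂ F := by
  ext y
  simp only [mem_nbhd, Finset.mem_union]
  grind

/-- The subsets of `A` of size at most `2 * M` still expand by a factor of two into `F`, where a
vertex of the forest `Y ⊆ F` with parent function `p` only counts for its own parent. -/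
def ForestExpands (G : SimpleGraph V) (A F : Finset V) (M : ℕ) (Y : Finset V) (p : V → V) :
    Prop :=
  ∀ U ⊆ A, U.card ≤ 2 * M →
    2 * U.card ≤ (nbhd G U (F \ Y)).card + (Y.filter fun y => p y ∈ U).card

lemma card_children_union (Y U₁ U₂ : Finset V) (p : V → V) :
    (Y.filter fun y => p y ∈ U₁ ∪ U₂).card + (Y.filter fun y => p y ∈ U₁ ∩ U₂).card =
      (Y.filter fun y => p y ∈ U₁).card + (Y.filter fun y => p y ∈ U₂).card := by
  rw [← Finset.card_union_add_card_inter (Y.filter fun y => p y ∈ U₁)]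
  congr 2 <;> ext y <;> simp <;> tauto

lemma card_nbhd_union (G : SimpleGraph V) (U₁ U₂ F : Finset V) :
    (nbhd G (U₁ ∪ U₂) F).card + (nbhd G (U₁ ∩ U₂) F).card ≤
      (nbhd G U₁ F).card + (nbhd G U₂ F).card := by
  rw [← Finset.card_union_add_card_inter (nbhd G U₁ F), nbhd_union]
  gcongr
  intro y
  simp only [mem_nbhd, Finset.mem_inter]
  grind

/-- A vertex with fewer than two children can be given a new child so that the forest keeps
expanding. -/
lemma ForestExpands.exists_child {G : SimpleGraph V} {A F W L Y : Finset V} {M : ℕ} {p : V → V}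
    (h : ForestExpands G A F M Y p) (hM : 1 ≤ M) (hAW : A ⊆ W) (hFL : F ⊆ L)
    (hjoin : ∀ B ⊆ W, ∀ C ⊆ L, M ≤ B.card → M ≤ C.card → ∃ x ∈ B, ∃ y ∈ C, G.Adj x y)
    (hcard : 5 * M ≤ (F \ Y).card) {x : V} (hx : x ∈ A)
    (hch : (Y.filter fun y => p y = x).card < 2) :
    ∃ y ∈ F \ Y, G.Adj x y ∧ ForestExpands G A F M (insert y Y) (Function.update p y x) := by
  by_contra! hcon
  have tight_small : ∀ U ⊆ A, U.card ≤ 2 * M →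
      (nbhd G U (F \ Y)).card + (Y.filter fun y => p y ∈ U).card = 2 * U.card → U.card < M := by
    intro U hU hU2 ht
    by_contra! hUM
    have hC : ((F \ Y) \ nbhd G U (F \ Y)).card < M := by
      by_contra! hC
      obtain ⟨a, ha, b, hb, hab⟩ := hjoin U (hU.trans hAW) _
        ((Finset.sdiff_subset.trans Finset.sdiff_subset).trans hFL) hUM hC
      rw [Finset.mem_sdiff, mem_nbhd] at hb
      exact hb.2 ⟨hb.1, a, ha, hab⟩
    have := Finset.card_sdiff_add_card_eq_card (s := nbhd G U (F \ Y)) (t := F \ Y)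
      (fun y hy => (mem_nbhd.1 hy).1)
    omega
  have key : ∀ Z ⊆ nbhd G {x} (F \ Y), ∃ T ⊆ A, T.card < M ∧ x ∉ T ∧
      (nbhd G T (F \ Y)).card + (Y.filter fun y => p y ∈ T).card = 2 * T.card ∧
      Z ⊆ nbhd G T (F \ Y) := by
    intro Z
    induction Z using Finset.induction_on with
    | empty =>
      intro _
      exact ⟨∅, by simp, by simp; omega, by simp, by simp [nbhd], by simp⟩
    | insert y Z hyZ ih =>
      intro hZ
      obtain ⟨T, hTA, hTM, hxT, hT, hZT⟩ := ih ((Finset.subset_insert _ _).trans hZ)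
      have hy := mem_nbhd.1 (hZ (Finset.mem_insert_self y Z))
      obtain ⟨hyF, x', hx', hxy⟩ := hy
      rw [Finset.mem_singleton] at hx'
      subst hx'
      have hnot := hcon y hyF hxy
      simp only [ForestExpands, not_forall, not_le] at hnot
      obtain ⟨U, hUA, hU2, hlt⟩ := hnot
      have hU := h U hUA hU2
      have hyY : y ∉ Y := (Finset.mem_sdiff.1 hyF).2
      have hN : nbhd G U (F \ insert y Y) = (nbhd G U (F \ Y)).erase y := by
        ext z
        simp only [mem_nbhd, Finset.mem_sdiff, Finset.mem_insert, Finset.mem_erase]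
        tauto
      have hC : ((insert y Y).filter fun z => Function.update p y x' z ∈ U) =
          if x' ∈ U then insert y (Y.filter fun z => p z ∈ U)
          else Y.filter fun z => p z ∈ U := by
        rw [Finset.filter_insert]
        simp only [Function.update_self]
        have : (Y.filter fun z => Function.update p y x' z ∈ U) =
            Y.filter fun z => p z ∈ U := by
          apply Finset.filter_congr
          intro z hz
          rw [Function.update_of_ne (by rintro rfl; exact hyY hz)]
        rw [this]
      rw [hN, hC] at hlt
      have hers := Finset.card_erase_add_one (s := nbhd G U (F \ Y)) (a := y)
      have hxU : x' ∉ U := by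
        intro hxU
        have hyN : y ∈ nbhd G U (F \ Y) := mem_nbhd.2 ⟨hyF, x', hxU, hxy⟩
        rw [if_pos hxU, Finset.card_insert_of_notMem (by simp [hyY])] at hlt
        have := hers hyN
        omega
      rw [if_neg hxU] at hlt
      have hyN : y ∈ nbhd G U (F \ Y) := by
        by_contra hyN
        rw [Finset.erase_eq_of_notMem hyN] at hlt
        omega
      have hers := hers hyN
      have hUt : (nbhd G U (F \ Y)).card + (Y.filter fun y => p y ∈ U).card = 2 * U.card := by
        omega
      have hUM := tight_small U hUA hU2 hUt
      have hle := Finset.card_union_le T U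
      have hsub : T ∪ U ⊆ A := Finset.union_subset hTA hUA
      have h1 := card_nbhd_union G T U (F \ Y)
      have h2 := card_children_union Y T U p
      have h3 := Finset.card_union_add_card_inter T U
      have h4 := h (T ∪ U) hsub (by omega)
      have h5 := h (T ∩ U) (Finset.inter_subset_left.trans hTA)
        ((Finset.card_le_card Finset.inter_subset_left).trans (by omega))
      have ht : (nbhd G (T ∪ U) (F \ Y)).card + (Y.filter fun y => p y ∈ T ∪ U).card =
          2 * (T ∪ U).card := by omega
      refine ⟨T ∪ U, hsub, tight_small _ hsub (by omega) ht, by simp [hxT, hxU], ht, ?_⟩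
      rw [nbhd_union]
      exact Finset.insert_subset (Finset.mem_union_right _ hyN)
        (hZT.trans Finset.subset_union_left)
  obtain ⟨T, hTA, hTM, hxT, hT, hZT⟩ := key _ subset_rfl
  have h1 := h (T ∪ {x}) (Finset.union_subset hTA (by simpa using hx))
    ((Finset.card_union_le _ _).trans (by simp; omega))
  rw [nbhd_union, Finset.union_eq_left.2 hZT] at h1
  have h2 := card_children_union Y T {x} p
  have h3 : T ∩ {x} = ∅ := Finset.inter_singleton_of_notMem hxT
  have h4 := Finset.card_union_add_card_inter T {x}
  simp only [h3, Finset.notMem_empty, Finset.filter_false, Finset.card_empty,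
    Finset.mem_singleton, Finset.card_singleton] at h2 h4
  omega


/-- An expanding forest on `Y ⊆ F` whose edges `p y, y` are edges of `G`. -/
structure IsForest (G : SimpleGraph V) (A F : Finset V) (M : ℕ) (Y : Finset V) (p : V → V) :
    Prop where
  subset : Y ⊆ F
  adj : ∀ y ∈ Y, G.Adj (p y) y
  expands : ForestExpands G A F M Y p

lemma card_children_insert {Y : Finset V} {p : V → V} {x y : V} (hy : y ∉ Y) (z : V) :
    ((insert y Y).filter fun w => Function.update p y x w = z).card =
      (Y.filter fun w => p w = z).card + if x = z then 1 else 0 := by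
  have : (Y.filter fun w => Function.update p y x w = z) = Y.filter fun w => p w = z := by
    apply Finset.filter_congr
    intro w hw
    rw [Function.update_of_ne (by rintro rfl; exact hy hw)]
  rw [Finset.filter_insert, Function.update_self, this]
  split_ifs
  · rw [Finset.card_insert_of_notMem (by simp [hy])]
  · rfl

lemma IsForest.exists_insert {G : SimpleGraph V} {A F W L Y : Finset V} {M : ℕ} {p : V → V}
    (h : IsForest G A F M Y p) (hM : 1 ≤ M) (hAW : A ⊆ W) (hFL : F ⊆ L)
    (hjoin : ∀ B ⊆ W, ∀ C ⊆ L, M ≤ B.card → M ≤ C.card → ∃ x ∈ B, ∃ y ∈ C, G.Adj x y)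
    (hcard : 5 * M + Y.card ≤ F.card) {x : V} (hx : x ∈ A)
    (hch : (Y.filter fun y => p y = x).card < 2) :
    ∃ y, y ∉ Y ∧ IsForest G A F M (insert y Y) (Function.update p y x) := by
  have := Finset.card_sdiff_add_card_eq_card h.subset
  obtain ⟨y, hy, hxy, he⟩ := h.expands.exists_child hM hAW hFL hjoin (by omega) hx hch
  rw [Finset.mem_sdiff] at hy
  refine ⟨y, hy.2, Finset.insert_subset hy.1 h.subset, ?_, he⟩
  intro z hz
  by_cases hzy : z = y
  · subst hzy
    simpa using hxy
  · rw [Function.update_of_ne hzy]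
    exact h.adj z (Finset.mem_of_mem_insert_of_ne hz hzy)

/-- Every vertex of a set of leaves can be given exactly two children. -/
lemma IsForest.exists_level {G : SimpleGraph V} {A F W L Y : Finset V} {M : ℕ} {p : V → V}
    (h : IsForest G A F M Y p) (hM : 1 ≤ M) (hAW : A ⊆ W) (hFL : F ⊆ L)
    (hjoin : ∀ B ⊆ W, ∀ C ⊆ L, M ≤ B.card → M ≤ C.card → ∃ x ∈ B, ∃ y ∈ C, G.Adj x y)
    (X : Finset V) (hX : X ⊆ A) (hleaf : ∀ y ∈ Y, p y ∉ X)
    (hcard : 5 * M + Y.card + 2 * X.card ≤ F.card) :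
    ∃ Y' p', IsForest G A F M Y' p' ∧ Y ⊆ Y' ∧ (∀ y ∈ Y, p' y = p y) ∧
      (∀ y ∈ Y', y ∉ Y → p' y ∈ X) ∧ (∀ x ∈ X, (Y'.filter fun y => p' y = x).card = 2) ∧
      Y'.card = Y.card + 2 * X.card := by
  induction X using Finset.induction_on with
  | empty => exact ⟨Y, p, h, subset_rfl, fun _ _ => rfl, by grind, by simp, by simp⟩
  | insert x X hxX ih =>
    rw [Finset.card_insert_of_notMem hxX] at hcard
    obtain ⟨Y', p', hf, hYY', hp', hnew, htwo, hc⟩ := ih ((Finset.subset_insert _ _).trans hX)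
      (fun y hy hyX => hleaf y hy (Finset.mem_insert_of_mem hyX)) (by omega)
    have hxA : x ∈ A := hX (Finset.mem_insert_self _ _)
    have h0 : (Y'.filter fun y => p' y = x).card = 0 := by
      rw [Finset.card_eq_zero, Finset.filter_eq_empty_iff]
      intro y hy hyx
      by_cases hyY : y ∈ Y
      · exact hleaf y hyY (by rw [← hp' y hyY, hyx]; exact Finset.mem_insert_self _ _)
      · exact hxX (hyx ▸ hnew y hy hyY)
    obtain ⟨a, ha, hfa⟩ := hf.exists_insert hM hAW hFL hjoin (by omega) hxA (by omega)
    have hca := Finset.card_insert_of_notMem ha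
    obtain ⟨b, hb, hfb⟩ := hfa.exists_insert hM hAW hFL hjoin (by omega) hxA
      (by rw [card_children_insert ha]; simp [h0])
    have hcb := Finset.card_insert_of_notMem hb
    have hbY : b ∉ Y' := fun hbY => hb (Finset.mem_insert_of_mem hbY)
    have hupd : ∀ y ∈ Y', Function.update (Function.update p' a x) b x y = p' y := by
      intro y hy
      rw [Function.update_of_ne (by rintro rfl; exact hbY hy),
        Function.update_of_ne (by rintro rfl; exact ha hy)]
    refine ⟨_, _, hfb, ?_, ?_, ?_, ?_, ?_⟩
    · exact hYY'.trans ((Finset.subset_insert _ _).trans (Finset.subset_insert _ _))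
    · intro y hy
      rw [hupd y (hYY' hy), hp' y hy]
    · intro y hy hyY
      by_cases hyY' : y ∈ Y'
      · rw [hupd y hyY']
        exact Finset.mem_insert_of_mem (hnew y hyY' hyY)
      · have : y = b ∨ y = a := by simpa [hyY'] using hy
        rcases this with rfl | rfl
        · simp
        · by_cases hab : y = b <;> simp [hab]
    · intro z hz
      rw [card_children_insert hb, card_children_insert ha]
      rcases Finset.mem_insert.1 hz with rfl | hz
      · simp [h0]
      · rw [htwo z hz, if_neg (by rintro rfl; exact hxX hz)]
    · rw [Finset.card_insert_of_notMem hxX]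
      omega

lemma card_filter_parent_mem {Y X : Finset V} {p : V → V}
    (htwo : ∀ x ∈ X, (Y.filter fun y => p y = x).card = 2) :
    (Y.filter fun y => p y ∈ X).card = 2 * X.card := by
  have hmaps : ∀ y ∈ Y.filter (fun y => p y ∈ X), p y ∈ X :=
    fun y hy => (Finset.mem_filter.1 hy).2
  rw [Finset.card_eq_sum_card_fiberwise hmaps, mul_comm, ← smul_eq_mul, ← Finset.sum_const]
  refine Finset.sum_congr rfl fun x hx => ?_
  rw [Finset.filter_filter, ← htwo x hx]
  congr 1
  apply Finset.filter_congr
  grind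

/-- Two binary trees of depth `k` with roots `u` and `v` can be grown simultaneously; `S` and `T`
are their sets of leaves. -/
lemma exists_binary_trees {G : SimpleGraph V} {A F W L : Finset V} {M : ℕ}
    (h : ∀ U ⊆ A, U.card ≤ 2 * M → 2 * U.card ≤ (nbhd G U F).card)
    (hM : 1 ≤ M) (hAW : A ⊆ W) (hFL : F ⊆ L) (hFA : F ⊆ A)
    (hjoin : ∀ B ⊆ W, ∀ C ⊆ L, M ≤ B.card → M ≤ C.card → ∃ x ∈ B, ∃ y ∈ C, G.Adj x y)
    {u v : V} (hu : u ∈ A) (hv : v ∈ A) (huF : u ∉ F) (hvF : v ∉ F) (huv : u ≠ v) (k : ℕ)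
    (hcard : 5 * M + 4 * 2 ^ k ≤ F.card) :
    ∃ Y p S T, IsForest G A F M Y p ∧ Disjoint S T ∧ S.card = 2 ^ k ∧ T.card = 2 ^ k ∧
      Y.card ≤ 4 * 2 ^ k ∧ (∀ y ∈ Y, p y ∉ S ∧ p y ∉ T) ∧ (∀ y ∈ Y, p y ∈ Y ∪ {u, v}) ∧
      S ⊆ Y ∪ {u, v} ∧ T ⊆ Y ∪ {u, v} ∧ (1 ≤ k → S ⊆ Y ∧ T ⊆ Y) ∧
      (∀ x ∈ S, ∃ Q ⊆ Y, Q.card ≤ k ∧ (∀ y ∈ Q, p y ∈ Q ∪ {u}) ∧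
        ∃ w : G.Walk u x, ∀ z ∈ w.support, z ∈ Q ∪ {u}) ∧
      (∀ x ∈ T, ∃ Q ⊆ Y, Q.card ≤ k ∧ (∀ y ∈ Q, p y ∈ Q ∪ {v}) ∧
        ∃ w : G.Walk v x, ∀ z ∈ w.support, z ∈ Q ∪ {v}) := by
  induction k with
  | zero =>
    refine ⟨∅, id, {u}, {v}, ⟨by simp, by simp, ?_⟩, by simpa using huv, by simp, by simp, by simp,
      by simp, by simp, by simp, by simp, by simp, ?_, ?_⟩
    · intro U hU hU2
      simpa using h U hU hU2
    · intro x hx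
      rw [Finset.mem_singleton] at hx
      subst hx
      exact ⟨∅, by simp, by simp, by simp, .nil, by simp⟩
    · intro x hx
      rw [Finset.mem_singleton] at hx
      subst hx
      exact ⟨∅, by simp, by simp, by simp, .nil, by simp⟩
  | succ k ih =>
    rw [pow_succ] at hcard
    obtain ⟨Y, p, S, T, hf, hST, hS, hT, hY, hleaf, hpar, hSY, hTY, -, hSw, hTw⟩ :=
      ih (by omega)
    have hrootA : Y ∪ {u, v} ⊆ A := by
      refine Finset.union_subset (hf.subset.trans hFA) ?_
      simp [Finset.insert_subset_iff, hu, hv]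
    have hcX := Finset.card_union_of_disjoint hST
    obtain ⟨Y', p', hf', hYY', hp', hnew, htwo, hc⟩ := hf.exists_level hM hAW hFL hjoin (S ∪ T)
      (Finset.union_subset (hSY.trans hrootA) (hTY.trans hrootA))
      (fun y hy => by simpa using hleaf y hy) (by omega)
    have hST' : S ∪ T ⊆ Y ∪ {u, v} := Finset.union_subset hSY hTY
    have hroot : ∀ z ∈ Y', z ∈ Y ∪ {u, v} → z ∈ Y := by
      intro z hz hz'
      have := hf'.subset hz
      simp only [Finset.mem_union, Finset.mem_insert, Finset.mem_singleton] at hz'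
      rcases hz' with hz' | rfl | rfl
      · exact hz'
      · exact absurd this huF
      · exact absurd this hvF
    have hgrand : ∀ y ∈ Y', p' y ∈ Y' → p' (p' y) ∉ S ∪ T := by
      intro y hy hpy
      have : p' y ∈ Y := by
        by_cases hyY : y ∈ Y
        · exact hroot _ hpy (hp' y hyY ▸ hpar y hyY)
        · exact hroot _ hpy (hST' (hnew y hy hyY))
      rw [hp' _ this]
      simpa using hleaf _ this
    have hwalk : ∀ (r : V) (R : Finset V),
        (∀ x ∈ R, ∃ Q ⊆ Y, Q.card ≤ k ∧ (∀ y ∈ Q, p y ∈ Q ∪ {r}) ∧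
          ∃ w : G.Walk r x, ∀ z ∈ w.support, z ∈ Q ∪ {r}) →
        ∀ x ∈ Y'.filter (fun y => p' y ∈ R), ∃ Q ⊆ Y', Q.card ≤ k + 1 ∧
          (∀ y ∈ Q, p' y ∈ Q ∪ {r}) ∧ ∃ w : G.Walk r x, ∀ z ∈ w.support, z ∈ Q ∪ {r} := by
      intro r R hR x hx
      rw [Finset.mem_filter] at hx
      obtain ⟨Q, hQY, hQk, hQp, w, hw⟩ := hR _ hx.2
      refine ⟨insert x Q, Finset.insert_subset hx.1 (hQY.trans hYY'),
        (Finset.card_insert_le _ _).trans (by omega), ?_, w.concat (hf'.adj x hx.1), ?_⟩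
      · intro y hy
        rcases Finset.mem_insert.1 hy with rfl | hy
        · have := hw _ w.end_mem_support
          grind
        · have := hQp y hy
          rw [hp' y (hQY hy)]
          grind
      · intro z hz
        rw [SimpleGraph.Walk.support_concat, List.mem_append,
          List.mem_singleton] at hz
        rcases hz with hz | rfl
        · have := hw z hz
          grind
        · simp
    refine ⟨Y', p', Y'.filter (fun y => p' y ∈ S), Y'.filter (fun y => p' y ∈ T), hf', ?_, ?_, ?_,
      ?_, ?_, ?_, ?_, ?_, ?_, hwalk u S hSw, hwalk v T hTw⟩
    · rw [Finset.disjoint_left] at hST ⊢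
      intro y hy hy'
      exact hST (Finset.mem_filter.1 hy).2 (Finset.mem_filter.1 hy').2
    · rw [card_filter_parent_mem fun x hx => htwo x (Finset.mem_union_left _ hx), hS, pow_succ]
      ring
    · rw [card_filter_parent_mem fun x hx => htwo x (Finset.mem_union_right _ hx), hT, pow_succ]
      ring
    · rw [pow_succ]
      omega
    · intro y hy
      have := hgrand y hy
      grind
    · intro y hy
      by_cases hyY : y ∈ Y
      · have := hpar y hyY
        rw [hp' y hyY]
        grind
      · have := hST' (hnew y hy hyY)
        grind
    · exact (Finset.filter_subset _ _).trans Finset.subset_union_left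
    · exact (Finset.filter_subset _ _).trans Finset.subset_union_left
    · exact fun _ => ⟨Finset.filter_subset _ _, Finset.filter_subset _ _⟩

/-- Two vertices are joined by a short path through `F` whose removal preserves expansion. -/
lemma exists_path_expanding {G : SimpleGraph V} {A F W L : Finset V} {M k : ℕ}
    (h : ∀ U ⊆ A, U.card ≤ 2 * M → 2 * U.card ≤ (nbhd G U F).card)
    (hM : 1 ≤ M) (hAW : A ⊆ W) (hFL : F ⊆ L) (hFA : F ⊆ A) (hLW : L ⊆ W)
    (hjoin : ∀ B ⊆ W, ∀ C ⊆ L, M ≤ B.card → M ≤ C.card → ∃ x ∈ B, ∃ y ∈ C, G.Adj x y)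
    {u v : V} (hu : u ∈ A) (hv : v ∈ A) (huF : u ∉ F) (hvF : v ∉ F) (huv : u ≠ v)
    (hk : 1 ≤ k) (hMk : M ≤ 2 ^ k) (hcard : 5 * M + 4 * 2 ^ k ≤ F.card) :
    ∃ P ⊆ F, P.card ≤ 2 * k ∧ (∃ w : G.Walk u v, ∀ z ∈ w.support, z ∈ P ∪ {u, v}) ∧
      ∀ U ⊆ A \ (P ∪ {u, v}), U.card ≤ 2 * M → 2 * U.card ≤ (nbhd G U (F \ P)).card := by
  obtain ⟨Y, p, S, T, hf, hST, hS, hT, hY, hleaf, hpar, -, -, hSTY, hSw, hTw⟩ :=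
    exists_binary_trees h hM hAW hFL hFA hjoin hu hv huF hvF huv k hcard
  obtain ⟨hSY, hTY⟩ := hSTY hk
  obtain ⟨x, hx, y, hy, hxy⟩ := hjoin S (hSY.trans (hf.subset.trans (hFL.trans hLW))) T
    (hTY.trans (hf.subset.trans hFL)) (hS ▸ hMk) (hT ▸ hMk)
  obtain ⟨Q, hQY, hQk, hQp, w, hw⟩ := hSw x hx
  obtain ⟨R, hRY, hRk, hRp, w', hw'⟩ := hTw y hy
  have hPY : Q ∪ R ⊆ Y := Finset.union_subset hQY hRY
  refine ⟨Q ∪ R, hPY.trans hf.subset, (Finset.card_union_le _ _).trans (by omega),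
    ⟨w.append (.cons hxy w'.reverse), ?_⟩, ?_⟩
  · intro z hz
    rw [SimpleGraph.Walk.mem_support_append_iff, SimpleGraph.Walk.support_cons, List.mem_cons,
      SimpleGraph.Walk.support_reverse, List.mem_reverse] at hz
    have h1 := hw z
    have h2 := hw' z
    have h3 := hw x w.end_mem_support
    grind
  · intro U hU hU2
    refine (hf.expands U (hU.trans Finset.sdiff_subset) hU2).trans ?_
    rw [← Finset.card_union_of_disjoint]
    · refine Finset.card_le_card ?_
      intro z hz
      rw [Finset.mem_union, mem_nbhd, Finset.mem_filter] at hz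
      rw [mem_nbhd]
      rcases hz with ⟨hz, hz'⟩ | ⟨hzY, hz⟩
      · exact ⟨Finset.sdiff_subset_sdiff subset_rfl hPY hz, hz'⟩
      · refine ⟨Finset.mem_sdiff.2 ⟨hf.subset hzY, fun hzP => ?_⟩, p z, hz, hf.adj z hzY⟩
        have h1 := hU hz
        have h2 := hQp z
        have h3 := hRp z
        grind
    · rw [Finset.disjoint_left]
      intro z hz hz'
      exact (Finset.mem_sdiff.1 (mem_nbhd.1 hz).1).2 (Finset.mem_filter.1 hz').1

/-- In an expanding graph, prescribed pairs of vertices can be joined by disjoint paths. -/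
theorem exists_linkage {ι : Type*} [DecidableEq ι] {G : SimpleGraph V} {W L : Finset V} {M k : ℕ}
    (hM : 1 ≤ M) (hLW : L ⊆ W)
    (hjoin : ∀ B ⊆ W, ∀ C ⊆ L, M ≤ B.card → M ≤ C.card → ∃ x ∈ B, ∃ y ∈ C, G.Adj x y)
    (hk : 1 ≤ k) (hMk : M ≤ 2 ^ k) (u v : ι → V) (hu : Function.Injective u)
    (hv : Function.Injective v) (huv : ∀ i j, u i ≠ v j) (huL : ∀ i, u i ∉ L) (hvL : ∀ i, v i ∉ L)
    (huW : ∀ i, u i ∈ W) (hvW : ∀ i, v i ∈ W) (I : Finset ι) (F : Finset V) (hFL : F ⊆ L)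
    (h : ∀ U ⊆ F ∪ (I.image u ∪ I.image v), U.card ≤ 2 * M → 2 * U.card ≤ (nbhd G U F).card)
    (hcard : 2 * k * I.card + (5 * M + 4 * 2 ^ k) ≤ F.card) :
    ∃ P : ι → Finset V, (∀ i ∈ I, P i ⊆ F) ∧
      (∀ i ∈ I, ∀ j ∈ I, i ≠ j → Disjoint (P i) (P j)) ∧
      ∀ i ∈ I, ∃ w : G.Walk (u i) (v i), ∀ z ∈ w.support, z ∈ P i ∪ {u i, v i} := by
  induction I using Finset.induction_on generalizing F with
  | empty => exact ⟨fun _ => ∅, by simp, by simp, by simp⟩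
  | insert i I hi ih =>
    rw [Finset.card_insert_of_notMem hi, mul_add] at hcard
    have hAW : F ∪ ((insert i I).image u ∪ (insert i I).image v) ⊆ W := by
      refine Finset.union_subset (hFL.trans hLW) (Finset.union_subset ?_ ?_) <;>
      · rw [Finset.image_subset_iff]
        grind
    obtain ⟨P, hPF, hPk, hPw, hPe⟩ := exists_path_expanding h hM hAW hFL Finset.subset_union_left
      hLW hjoin (u := u i) (v := v i) (by simp) (by simp) (fun hF => huL i (hFL hF))
      (fun hF => hvL i (hFL hF)) (huv i i) hk hMk (by omega)
    have hc := Finset.card_sdiff_add_card_eq_card hPF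
    obtain ⟨P', hP'F, hP'd, hP'w⟩ := ih (F \ P) (Finset.sdiff_subset.trans hFL) (by
      intro U hU hU2
      refine hPe U (hU.trans ?_) hU2
      intro z hz
      have hz' : (z ∈ F ∧ z ∉ P) ∨ (∃ j ∈ I, u j = z) ∨ ∃ j ∈ I, v j = z := by
        simpa using hz
      simp only [Finset.mem_sdiff, Finset.mem_union, Finset.mem_image, Finset.mem_insert,
        Finset.mem_singleton]
      rcases hz' with ⟨hzF, hzP⟩ | ⟨j, hj, rfl⟩ | ⟨j, hj, rfl⟩
      · refine ⟨Or.inl hzF, ?_⟩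
        have h1 := huL i
        have h2 := hvL i
        have h3 := hFL hzF
        grind
      · refine ⟨Or.inr (Or.inl ⟨j, Or.inr hj, rfl⟩), ?_⟩
        have h1 : u j ∉ P := fun hP => huL j (hFL (hPF hP))
        have h2 : u j ≠ u i := fun hP => hi (hu hP ▸ hj)
        have h3 := huv j i
        tauto
      · refine ⟨Or.inr (Or.inr ⟨j, Or.inr hj, rfl⟩), ?_⟩
        have h1 : v j ∉ P := fun hP => hvL j (hFL (hPF hP))
        have h2 : v j ≠ v i := fun hP => hi (hv hP ▸ hj)
        have h3 := (huv i j).symm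
        tauto) (by omega)
    refine ⟨Function.update P' i P, ?_, ?_, ?_⟩
    · intro j hj
      by_cases hji : j = i
      · subst hji
        simpa using hPF
      · rw [Function.update_of_ne hji]
        exact (hP'F j (Finset.mem_of_mem_insert_of_ne hj hji)).trans Finset.sdiff_subset
    · have hd : ∀ j ∈ I, Disjoint P (P' j) := fun j hj =>
        Finset.disjoint_left.2 fun z hz hz' => (Finset.mem_sdiff.1 (hP'F j hj hz')).2 hz
      intro a ha b hb hab
      by_cases hai : a = i
      · subst hai
        rw [Function.update_self, Function.update_of_ne hab.symm]
        exact hd b (Finset.mem_of_mem_insert_of_ne hb hab.symm)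
      · have haI := Finset.mem_of_mem_insert_of_ne ha hai
        rw [Function.update_of_ne hai]
        by_cases hbi : b = i
        · subst hbi
          rw [Function.update_self]
          exact (hd a haI).symm
        · rw [Function.update_of_ne hbi]
          exact hP'd a haI b (Finset.mem_of_mem_insert_of_ne hb hbi) hab
    · intro j hj
      by_cases hji : j = i
      · subst hji
        simpa using hPw
      · rw [Function.update_of_ne hji]
        exact hP'w j (Finset.mem_of_mem_insert_of_ne hj hji)

end Linking

/-! ### Topological cliques in lifts -/

section TopologicalCliques

lemma SimpleGraph.Walk.snd_eq_or_mem_dropLast_tail_support {V : Type*} {G : SimpleGraph V}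
    {u v : V} (p : G.Walk u v) (huv : u ≠ v) :
    p.snd = v ∨ p.snd ∈ p.support.tail.dropLast := by
  cases p with
  | nil => exact absurd rfl huv
  | cons h q =>
    cases q with
    | nil => left; rfl
    | cons h' q' =>
      right
      simp [List.dropLast_cons_of_ne_nil]

lemma SimpleGraph.Walk.IsPath.mem_dropLast_tail_support {V : Type*} {G : SimpleGraph V}
    {u v : V} {p : G.Walk u v} (hp : p.IsPath) {x : V} (hx : x ∈ p.support.tail.dropLast) :
    x ∈ p.support ∧ x ≠ u ∧ x ≠ v := by
  have hn := hp.support_nodup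
  cases p with
  | nil => simp at hx
  | cons h q =>
    simp only [support_cons, List.tail_cons, List.nodup_cons] at hx hn ⊢
    refine ⟨List.mem_cons_of_mem _ (List.mem_of_mem_dropLast hx), ?_, ?_⟩
    · rintro rfl
      exact hn.1 (List.mem_of_mem_dropLast hx)
    · rintro rfl
      have h2 := hn.2
      rw [← List.dropLast_append_getLast q.support_ne_nil, List.nodup_append] at h2
      exact h2.2.2 _ hx _ (by simp) rfl

lemma HasTopClique.of_walks {V : Type*} [DecidableEq V] {G : SimpleGraph V} {m : ℕ}
    (f : Fin m → V) (hf : Function.Injective f) (I : Fin m → Fin m → Finset V)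
    (hfI : ∀ i j, i < j → ∀ k, f k ∉ I i j)
    (hI : ∀ i j i' j', i < j → i' < j' → (i, j) ≠ (i', j') → Disjoint (I i j) (I i' j'))
    (hw : ∀ i j, i < j → ∃ w : G.Walk (f i) (f j), ∀ z ∈ w.support, z ∈ I i j ∪ {f i, f j}) :
    HasTopClique G m := by
  have hex : ∀ i j, ∃ w : G.Walk (f i) (f j), i < j →
      w.IsPath ∧ ∀ z ∈ w.support.tail.dropLast, z ∈ I i j := by
    intro i j
    rcases lt_trichotomy i j with h | h | h
    · obtain ⟨w, hw⟩ := hw i j h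
      refine ⟨w.bypass, fun _ => ⟨w.bypass_isPath, fun z hz => ?_⟩⟩
      obtain ⟨h1, h2, h3⟩ := w.bypass_isPath.mem_dropLast_tail_support hz
      have := hw z (w.support_bypass_subset_support h1)
      simpa [h2, h3] using this
    · subst h
      exact ⟨.nil, fun h => absurd h (lt_irrefl _)⟩
    · obtain ⟨w, -⟩ := hw j i h
      exact ⟨w.reverse, fun h' => absurd h h'.not_gt⟩
  choose P hP using hex
  refine ⟨f, hf, P, fun i j h => (hP i j h).1, fun i j h k hk => hfI i j h k ((hP i j h).2 _ hk),
    fun i j i' j' h h' hne x hx hx' => ?_⟩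
  exact Finset.disjoint_left.1 (hI i j i' j' h h' hne) ((hP i j h).2 _ hx) ((hP i' j' h').2 _ hx')

/-- The permutation along which the lift joins the fibers of `j` and `k`, read from `j` to `k`. -/
def fiberPerm {n ℓ : ℕ} (σ : Fin n → Fin n → Equiv.Perm (Fin ℓ)) (j k : Fin n) :
    Equiv.Perm (Fin ℓ) :=
  if j < k then σ j k else (σ k j)⁻¹

variable {n ℓ : ℕ} {σ : Fin n → Fin n → Equiv.Perm (Fin ℓ)}

lemma fiberPerm_inv {j k : Fin n} (h : j ≠ k) : (fiberPerm σ j k)⁻¹ = fiberPerm σ k j := by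
  rcases lt_or_gt_of_ne h with h | h <;> simp [fiberPerm, h, h.not_gt]

lemma liftGraph_adj {x y : Fin n × Fin ℓ} :
    (liftGraph n ℓ σ).Adj x y ↔ x.1 ≠ y.1 ∧ fiberPerm σ x.1 y.1 x.2 = y.2 := by
  rw [liftGraph, SimpleGraph.fromRel_adj]
  rcases lt_trichotomy x.1 y.1 with h | h | h
  · have : x ≠ y := fun hxy => h.ne (congrArg _ hxy)
    simp [fiberPerm, h, h.not_gt, h.ne, this]
  · simp [h]
  · have : x ≠ y := fun hxy => h.ne' (congrArg _ hxy)
    simp only [ne_eq, this, not_false_eq_true, h.not_gt, false_and, h, true_and, false_or,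
      fiberPerm, if_false, h.ne']
    rw [Equiv.Perm.inv_eq_iff_eq]
    exact eq_comm

lemma HasTopClique.le_of_liftGraph (hn : 1 ≤ n) {m : ℕ} (h : HasTopClique (liftGraph n ℓ σ) m) :
    m ≤ n := by
  obtain ⟨f, hf, P, -, hbranch, hdisj⟩ := h
  cases m with
  | zero => exact Nat.zero_le _
  | succ m =>
    have hne : ∀ j : Fin m, f 0 ≠ f j.succ := fun j hj => (Fin.succ_ne_zero j) (hf hj).symm
    have hadj : ∀ j : Fin m, (liftGraph n ℓ σ).Adj (f 0) (P 0 j.succ).snd := fun j =>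
      (P 0 j.succ).adj_snd (SimpleGraph.Walk.not_nil_of_ne (hne j))
    have hinj : Function.Injective fun j : Fin m => (P 0 j.succ).snd := by
      intro i j hij
      by_contra hne'
      have hs : i.succ ≠ j.succ := fun h => hne' (Fin.succ_injective _ h)
      simp only at hij
      rcases (P 0 i.succ).snd_eq_or_mem_dropLast_tail_support (hne i) with hi | hi <;>
        rcases (P 0 j.succ).snd_eq_or_mem_dropLast_tail_support (hne j) with hj | hj
      · exact hs (hf (hi.symm.trans (hij.trans hj)))
      · exact hbranch 0 j.succ (Fin.succ_pos j) i.succ (by rwa [← hi, hij])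
      · exact hbranch 0 i.succ (Fin.succ_pos i) j.succ (by rwa [← hj, ← hij])
      · exact hdisj 0 i.succ 0 j.succ (Fin.succ_pos i) (Fin.succ_pos j) (by simpa using hne') _ hi
          (by rwa [hij])
    have hcard := Fintype.card_le_of_injective
      (fun j : Fin m => (⟨(P 0 j.succ).snd.1, (liftGraph_adj.1 (hadj j)).1.symm⟩ :
        {i : Fin n // i ≠ (f 0).1})) (by
      intro i j hij
      have h1 : (P 0 i.succ).snd.1 = (P 0 j.succ).snd.1 := congrArg Subtype.val hij
      apply hinj
      refine Prod.ext h1 ?_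
      rw [← (liftGraph_adj.1 (hadj i)).2, ← (liftGraph_adj.1 (hadj j)).2, h1])
    rw [Fintype.card_fin, Fintype.card_subtype_compl, Fintype.card_fin,
      Fintype.card_subtype_eq] at hcard
    omega

lemma hajosNumber_liftGraph_eq (hn : 1 ≤ n) (h : HasTopClique (liftGraph n ℓ σ) n) :
    hajosNumber (liftGraph n ℓ σ) = n :=
  le_antisymm (csSup_le ⟨n, h⟩ fun _ hm => HasTopClique.le_of_liftGraph hn hm)
    (le_csSup ⟨n, fun _ hm => HasTopClique.le_of_liftGraph hn hm⟩ h)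

end TopologicalCliques

/-! ### Assigning neighbours of the branch vertices to pairs of branch vertices -/

section Assignment

variable {n : ℕ} [NeZero n] {r : Fin n × Fin n → Fin n × Fin n → Prop}

open scoped Classical in
/-- The ordered pairs `(a, b)` whose assigned vertices `(c a b, a)` and `(c b a, b)` are not
related by `r`. -/
noncomputable def unmatchedPairs (r : Fin n × Fin n → Fin n × Fin n → Prop)
    (c : Fin n → Equiv.Perm (Fin n)) : Finset (Fin n × Fin n) :=
  Finset.univ.filter fun p => p.1 ≠ p.2 ∧ ¬ r (c p.1 p.2, p.1) (c p.2 p.1, p.2)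

omit [NeZero n] in
lemma mem_unmatchedPairs {c : Fin n → Equiv.Perm (Fin n)} {a b : Fin n} :
    (a, b) ∈ unmatchedPairs r c ↔ a ≠ b ∧ ¬ r (c a b, a) (c b a, b) := by
  simp [unmatchedPairs]

omit [NeZero n] in
lemma mem_unmatchedPairs_comm (hr : ∀ x y, r x y → r y x) {c : Fin n → Equiv.Perm (Fin n)}
    {a b : Fin n} (h : (a, b) ∈ unmatchedPairs r c) : (b, a) ∈ unmatchedPairs r c := by
  rw [mem_unmatchedPairs] at h ⊢
  exact ⟨h.1.symm, fun h' => h.2 (hr _ _ h')⟩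

/-- In an assignment with the fewest unmatched pairs, unmatched vertices are never related. -/
lemma exists_optimal_assignment (hr : ∀ x y, r x y → r y x) :
    ∃ c : Fin n → Equiv.Perm (Fin n), (∀ a, c a a = 0) ∧
      ∀ a b a' b', (a, b) ∈ unmatchedPairs r c → (a, b') ∈ unmatchedPairs r c →
        (b, a') ∈ unmatchedPairs r c → ¬ r (c a b', a) (c b a', b) := by
  obtain ⟨c, hc, hmin⟩ := Set.exists_min_image
    {c : Fin n → Equiv.Perm (Fin n) | ∀ a, c a a = 0} (fun c => (unmatchedPairs r c).card)
    (Set.toFinite _) ⟨fun a => Equiv.swap a 0, fun a => by simp⟩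
  refine ⟨c, hc, fun a b a' b' hab hab' hba' hrel => ?_⟩
  have hba := mem_unmatchedPairs_comm hr hab
  have hne : a ≠ b := (mem_unmatchedPairs.1 hab).1
  have hab'ne : a ≠ b' := (mem_unmatchedPairs.1 hab').1
  have hba'ne : b ≠ a' := (mem_unmatchedPairs.1 hba').1
  set d : Fin n → Equiv.Perm (Fin n) := Function.update
    (Function.update c a (c a * Equiv.swap b b')) b (c b * Equiv.swap a a') with hd
  have hda : d a = c a * Equiv.swap b b' := by simp [hd, hne]
  have hdb : d b = c b * Equiv.swap a a' := by simp [hd]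
  have hdx : ∀ x, x ≠ a → x ≠ b → d x = c x := fun x hxa hxb => by simp [hd, hxa, hxb]
  have hsame : ∀ x y, (x, y) ∉ unmatchedPairs r c → d x y = c x y := by
    intro x y hxy
    by_cases hxa : x = a
    · subst hxa
      rw [hda, Equiv.Perm.mul_apply, Equiv.swap_apply_of_ne_of_ne] <;> rintro rfl <;> contradiction
    · by_cases hxb : x = b
      · subst hxb
        rw [hdb, Equiv.Perm.mul_apply, Equiv.swap_apply_of_ne_of_ne] <;> rintro rfl <;>
          contradiction
      · rw [hdx x hxa hxb]
  have hd0 : ∀ x, d x x = 0 := fun x => by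
    rw [hsame x x (by simp [mem_unmatchedPairs]), hc]
  have hlt : (unmatchedPairs r d).card < (unmatchedPairs r c).card := by
    refine Finset.card_lt_card ⟨?_, fun hsub => ?_⟩
    · rintro ⟨x, y⟩ hxy
      by_contra hxy'
      have hyx' : (y, x) ∉ unmatchedPairs r c := fun h => hxy' (mem_unmatchedPairs_comm hr h)
      rw [mem_unmatchedPairs, hsame x y hxy', hsame y x hyx', ← mem_unmatchedPairs] at hxy
      exact hxy' hxy
    · refine (mem_unmatchedPairs.1 (hsub hab)).2 ?_
      rw [hda, hdb]
      simpa using hrel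
  exact absurd (hmin d hd0) (not_le.2 hlt)

/-- If no large family of candidate pairs is entirely unrelated, then some assignment leaves few
pairs unmatched. -/
lemma exists_assignment_card_lt (hr : ∀ x y, r x y → r y x) {s t : ℕ} (hts : t ≤ s)
    (h : ∀ (T : Finset (Fin n)) (R U : Fin n → Finset (Fin n)), T.card = t →
      (∀ a, 0 ∉ U a) → (∀ a ∈ T, a ∉ R a ∧ s ≤ (R a).card ∧ s ≤ (U a).card ∧
        ∀ b ∈ R a, s ≤ (U b).card) →
      ∃ a ∈ T, ∃ b ∈ R a, ∃ j ∈ U a, ∃ k ∈ U b, r (j, a) (k, b)) :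
    ∃ c : Fin n → Equiv.Perm (Fin n), (∀ a, c a a = 0) ∧
      (unmatchedPairs r c).card < 4 * s * n := by
  obtain ⟨c, hc, hopt⟩ := exists_optimal_assignment hr
  refine ⟨c, hc, ?_⟩
  by_contra! hbig
  set row : Fin n → Finset (Fin n) := fun a =>
    Finset.univ.filter fun b => (a, b) ∈ unmatchedPairs r c with hrow
  have mem_row : ∀ a b, b ∈ row a ↔ (a, b) ∈ unmatchedPairs r c := by simp [hrow]
  have hcard : (unmatchedPairs r c).card = ∑ a, (row a).card := by
    rw [Finset.card_eq_sum_card_fiberwise (f := Prod.fst) (t := Finset.univ) (by simp)]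
    refine Finset.sum_congr rfl fun a _ => ?_
    refine Finset.card_bij (fun p _ => p.2) ?_ ?_ ?_
    · rintro ⟨x, y⟩ hp
      simp only [Finset.mem_filter] at hp
      rw [mem_row]
      exact hp.2 ▸ hp.1
    · rintro ⟨x, y⟩ hp ⟨x', y'⟩ hp' hy
      simp only [Finset.mem_filter] at hp hp' hy
      rw [Prod.mk.injEq]
      exact ⟨hp.2.trans hp'.2.symm, hy⟩
    · intro b hb
      exact ⟨(a, b), by simpa using (mem_row a b).1 hb, rfl⟩
  set H : Finset (Fin n) := Finset.univ.filter fun a => s ≤ (row a).card with hH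
  have hlow : ∑ a ∈ Hᶜ, (row a).card ≤ s * n := by
    calc ∑ a ∈ Hᶜ, (row a).card ≤ ∑ a ∈ Hᶜ, s :=
          Finset.sum_le_sum fun a ha => by simp [hH] at ha; omega
      _ ≤ s * n := by
          rw [Finset.sum_const, smul_eq_mul, mul_comm]
          gcongr
          simpa using Finset.card_le_univ Hᶜ
  have hsplit : ∑ a, (row a).card = ∑ a ∈ H, (row a).card + ∑ a ∈ Hᶜ, (row a).card :=
    (Finset.sum_add_sum_compl H _).symm
  have hcross : ∑ a ∈ H, (row a \ H).card ≤ ∑ b ∈ Hᶜ, (row b).card := by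
    have h1 : ∀ a ∈ H, (row a \ H).card = ∑ b ∈ Hᶜ, if b ∈ row a then 1 else 0 := by
      intro a _
      rw [← Finset.sum_filter, Finset.sum_const, smul_eq_mul, mul_one]
      congr 1
      ext b
      simp [and_comm]
    rw [Finset.sum_congr rfl h1, Finset.sum_comm]
    refine Finset.sum_le_sum fun b _ => ?_
    rw [← Finset.sum_filter, Finset.sum_const, smul_eq_mul, mul_one]
    refine Finset.card_le_card fun a ha => ?_
    rw [Finset.mem_filter, mem_row] at ha
    rw [mem_row]
    exact mem_unmatchedPairs_comm hr ha.2
  have hinter : ∑ a ∈ H, (row a).card = ∑ a ∈ H, (row a ∩ H).card + ∑ a ∈ H, (row a \ H).card := by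
    rw [← Finset.sum_add_distrib]
    exact Finset.sum_congr rfl fun a _ => (Finset.card_inter_add_card_sdiff _ _).symm
  set T₀ : Finset (Fin n) := H.filter fun a => s ≤ (row a ∩ H).card with hT₀
  have hT₀card : ∑ a ∈ H, (row a ∩ H).card ≤ T₀.card * n + s * n := by
    rw [← Finset.sum_filter_add_sum_filter_not H (fun a => s ≤ (row a ∩ H).card)]
    refine add_le_add ?_ ?_
    · rw [← smul_eq_mul, ← Finset.sum_const]
      exact Finset.sum_le_sum fun a _ => by simpa using Finset.card_le_univ (row a ∩ H)
    · refine (Finset.sum_le_sum (g := fun _ => s) fun a ha => ?_).trans ?_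
      · have := (Finset.mem_filter.1 ha).2
        omega
      · rw [Finset.sum_const, smul_eq_mul, mul_comm]
        gcongr
        simpa using Finset.card_le_univ (H.filter fun a => ¬ s ≤ (row a ∩ H).card)
  have hsT : s ≤ T₀.card := by
    have hnpos : 0 < n := Nat.pos_of_ne_zero (NeZero.ne n)
    have : s * n ≤ T₀.card * n := by nlinarith
    exact Nat.le_of_mul_le_mul_right this hnpos
  obtain ⟨T, hTT₀, hT⟩ := Finset.exists_subset_card_eq (hts.trans hsT)
  have hUcard : ∀ a, ((row a).image (c a)).card = (row a).card := fun a =>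
    Finset.card_image_of_injective _ (c a).injective
  obtain ⟨a, ha, b, hb, j, hj, k, hk, hrel⟩ := h T (fun a => row a ∩ H)
    (fun a => (row a).image (c a)) hT (by
      intro a h0
      obtain ⟨b, hb, hb0⟩ := Finset.mem_image.1 h0
      rw [mem_row, mem_unmatchedPairs] at hb
      exact hb.1 ((c a).injective (by rw [hc, hb0]))) (by
      intro a ha
      obtain ⟨haH, has⟩ := Finset.mem_filter.1 (hTT₀ ha)
      refine ⟨fun haa => ?_, has, ?_, fun b hb => ?_⟩
      · rw [Finset.mem_inter, mem_row, mem_unmatchedPairs] at haa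
        exact haa.1.1 rfl
      · rw [hUcard]
        exact (Finset.mem_filter.1 haH).2
      · rw [hUcard]
        exact (Finset.mem_filter.1 (Finset.mem_inter.1 hb).2).2)
  obtain ⟨b', hb', rfl⟩ := Finset.mem_image.1 hj
  obtain ⟨a', ha', rfl⟩ := Finset.mem_image.1 hk
  exact hopt a b a' b' ((mem_row _ _).1 (Finset.mem_inter.1 hb).1) ((mem_row _ _).1 hb')
    ((mem_row _ _).1 ha') hrel

end Assignment

/-! ### A topological clique with all branch vertices in one fiber -/

section OneFiber

variable {n ℓ : ℕ} [NeZero n]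

/-- The position in the fiber of `j` of the neighbour of the `a`-th vertex of the fiber of `0`. -/
def starPos (hℓ : n ≤ ℓ) (σ : Fin n → Fin n → Equiv.Perm (Fin ℓ)) (j a : Fin n) : Fin ℓ :=
  σ 0 j (Fin.castLE hℓ a)

/-- The vertices outside the fiber of `0` that are not adjacent to one of its first `n`
vertices. -/
def freeVertices (hℓ : n ≤ ℓ) (σ : Fin n → Fin n → Equiv.Perm (Fin ℓ)) :
    Finset (Fin n × Fin ℓ) :=
  Finset.univ.filter fun x => x.1 ≠ 0 ∧ ∀ a, x.2 ≠ starPos hℓ σ x.1 a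

/-- The adjacency relation of the lift on the neighbours of the first `n` vertices of the
fiber of `0`. -/
def StarAdj (hℓ : n ≤ ℓ) (σ : Fin n → Fin n → Equiv.Perm (Fin ℓ)) (x y : Fin n × Fin n) : Prop :=
  (liftGraph n ℓ σ).Adj (x.1, starPos hℓ σ x.1 x.2) (y.1, starPos hℓ σ y.1 y.2)

variable {hℓ : n ≤ ℓ} {σ : Fin n → Fin n → Equiv.Perm (Fin ℓ)}

lemma starPos_injective (j : Fin n) : Function.Injective (starPos hℓ σ j) := fun _ _ hab =>
  Fin.castLE_injective hℓ ((σ 0 j).injective hab)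

lemma starPos_adj {j : Fin n} (hj : j ≠ 0) (a : Fin n) :
    (liftGraph n ℓ σ).Adj (0, Fin.castLE hℓ a) (j, starPos hℓ σ j a) := by
  rw [liftGraph_adj]
  exact ⟨hj.symm, by simp [fiberPerm, starPos, Fin.pos_iff_ne_zero.2 hj]⟩

theorem hasTopClique_of_expanding {M k : ℕ} (hM : 1 ≤ M) (hk : 1 ≤ k) (hMk : M ≤ 2 ^ k)
    {c : Fin n → Equiv.Perm (Fin n)} (hc : ∀ a, c a a = 0)
    (hjoin : ∀ B C : Finset (Fin n × Fin ℓ), (∀ x ∈ B, x.1 ≠ 0) → (∀ x ∈ C, x.1 ≠ 0) →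
      M ≤ B.card → M ≤ C.card → ∃ x ∈ B, ∃ y ∈ C, (liftGraph n ℓ σ).Adj x y)
    (hexp : ∀ U : Finset (Fin n × Fin ℓ), (∀ x ∈ U, x.1 ≠ 0) → U.card ≤ 2 * M →
      2 * U.card ≤ (nbhd (liftGraph n ℓ σ) U (freeVertices hℓ σ)).card)
    (hcard : 2 * k * (unmatchedPairs (StarAdj hℓ σ) c).card + (5 * M + 4 * 2 ^ k) ≤
      (freeVertices hℓ σ).card) :
    HasTopClique (liftGraph n ℓ σ) n := by
  classical
  set L := freeVertices hℓ σ with hL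
  set W : Finset (Fin n × Fin ℓ) := Finset.univ.filter fun x => x.1 ≠ 0 with hW
  set star : Fin n → Fin n → Fin n × Fin ℓ := fun a b => (c a b, starPos hℓ σ (c a b) a) with hstar
  have hc0 : ∀ {a b}, a ≠ b → c a b ≠ 0 := fun {a _} hab h0 =>
    hab ((c a).injective (by rw [hc, h0]))
  have star_inj : ∀ {a b a' b'}, star a b = star a' b' → a = a' ∧ b = b' := by
    intro a b a' b' h
    simp only [hstar, Prod.mk.injEq] at h
    have h2 := h.2
    rw [← h.1] at h2
    obtain rfl := starPos_injective _ h2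
    exact ⟨rfl, (c a).injective h.1⟩
  have star_notMem : ∀ a b, star a b ∉ L := fun a b h =>
    (Finset.mem_filter.1 h).2.2 a rfl
  have star_fst : ∀ {a b}, a ≠ b → (star a b).1 ≠ 0 := fun hab => hc0 hab
  have L_fst : ∀ {x}, x ∈ L → x.1 ≠ 0 := fun hx => (Finset.mem_filter.1 hx).2.1
  let ι := {p : Fin n × Fin n // p.1 < p.2}
  let I : Finset ι := Finset.univ.filter fun p => p.1 ∈ unmatchedPairs (StarAdj hℓ σ) c
  have hI : I.card ≤ (unmatchedPairs (StarAdj hℓ σ) c).card :=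
    Finset.card_le_card_of_injOn Subtype.val (fun p hp => (Finset.mem_filter.1 hp).2)
      Subtype.val_injective.injOn
  obtain ⟨P, hPL, hPd, hPw⟩ := exists_linkage (G := liftGraph n ℓ σ) (W := W) (L := L) hM
    (fun x hx => by simpa [hW] using L_fst hx)
    (fun B hB C hC => hjoin B C (fun x hx => (Finset.mem_filter.1 (hB hx)).2)
      (fun x hx => L_fst (hC hx))) hk hMk
    (fun p : ι => star p.1.1 p.1.2) (fun p : ι => star p.1.2 p.1.1)
    (fun p q h => Subtype.ext (Prod.ext (star_inj h).1 (star_inj h).2))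
    (fun p q h => Subtype.ext (Prod.ext (star_inj h).2 (star_inj h).1))
    (fun p q h => by
      have h1 := (star_inj h).1
      have h2 := (star_inj h).2
      have h3 := p.2
      have h4 := q.2
      rw [h1, h2] at h3
      exact lt_asymm h3 h4)
    (fun p => star_notMem _ _) (fun p => star_notMem _ _)
    (fun p => by simpa [hW] using star_fst p.2.ne) (fun p => by simpa [hW] using star_fst p.2.ne')
    I L subset_rfl
    (fun U hU hU2 => hexp U (fun x hx => by
      have := hU hx
      simp only [Finset.mem_union, Finset.mem_image] at this
      rcases this with hx | ⟨p, -, rfl⟩ | ⟨p, -, rfl⟩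
      · exact L_fst hx
      · exact star_fst p.2.ne
      · exact star_fst p.2.ne') hU2)
    (le_trans (by gcongr) hcard)
  let J : Fin n → Fin n → Finset (Fin n × Fin ℓ) := fun a b =>
    {star a b, star b a} ∪ if h : a < b then (if (⟨(a, b), h⟩ : ι) ∈ I then P ⟨(a, b), h⟩ else ∅)
      else ∅
  have mem_J : ∀ {a b} (h : a < b) {z}, z ∈ J a b ↔
      (z = star a b ∨ z = star b a) ∨ ((⟨(a, b), h⟩ : ι) ∈ I ∧ z ∈ P ⟨(a, b), h⟩) := by
    intro a b h z
    simp only [J, h, dite_true, Finset.mem_union, Finset.mem_insert, Finset.mem_singleton]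
    split_ifs with h' <;> simp [h']
  refine HasTopClique.of_walks (fun a => ((0 : Fin n), Fin.castLE hℓ a))
    (fun a b hab => Fin.castLE_injective hℓ (Prod.ext_iff.1 hab).2) J ?_ ?_ ?_
  · intro a b hab d hd
    rw [mem_J hab] at hd
    rcases hd with (hd | hd) | ⟨hI, hd⟩
    · exact star_fst hab.ne (Prod.ext_iff.1 hd).1.symm
    · exact star_fst hab.ne' (Prod.ext_iff.1 hd).1.symm
    · exact L_fst (hPL _ hI hd) rfl
  · intro a b a' b' hab hab' hne
    rw [Finset.disjoint_left]
    intro z hz hz'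
    rw [mem_J hab] at hz
    rw [mem_J hab'] at hz'
    have hne' : (⟨(a, b), hab⟩ : ι) ≠ ⟨(a', b'), hab'⟩ := fun h => hne (congrArg Subtype.val h)
    rcases hz with (rfl | rfl) | ⟨hI, hz⟩ <;> rcases hz' with (hz' | hz') | ⟨hI', hz'⟩
    · exact hne (Prod.ext (star_inj hz').1 (star_inj hz').2)
    · have := star_inj hz'
      rw [this.1, this.2] at hab
      exact lt_asymm hab hab'
    · exact star_notMem _ _ (hPL _ hI' hz')
    · have := star_inj hz'
      rw [this.1, this.2] at hab
      exact lt_asymm hab hab'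
    · exact hne (Prod.ext (star_inj hz').2 (star_inj hz').1)
    · exact star_notMem _ _ (hPL _ hI' hz')
    · exact star_notMem _ _ (hz' ▸ hPL _ hI hz)
    · exact star_notMem _ _ (hz' ▸ hPL _ hI hz)
    · exact Finset.disjoint_left.1 (hPd _ hI _ hI' hne') hz hz'
  · intro a b hab
    have ha := starPos_adj (hℓ := hℓ) (σ := σ) (hc0 hab.ne) a
    have hb := (starPos_adj (hℓ := hℓ) (σ := σ) (hc0 hab.ne') b).symm
    have hmid : ∃ w : (liftGraph n ℓ σ).Walk (star a b) (star b a),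
        ∀ z ∈ w.support, z ∈ J a b := by
      by_cases hmem : (⟨(a, b), hab⟩ : ι) ∈ I
      · obtain ⟨w, hw⟩ := hPw _ hmem
        refine ⟨w, fun z hz => ?_⟩
        have := hw z hz
        simp only [Finset.mem_union, Finset.mem_insert, Finset.mem_singleton] at this
        rw [mem_J hab]
        tauto
      · have hadj : (liftGraph n ℓ σ).Adj (star a b) (star b a) := by
          by_contra hadj
          exact hmem (Finset.mem_filter.2 ⟨Finset.mem_univ _, mem_unmatchedPairs.2 ⟨hab.ne, hadj⟩⟩)
        refine ⟨hadj.toWalk, fun z hz => ?_⟩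
        rw [mem_J hab]
        left
        simpa using hz
    obtain ⟨w, hw⟩ := hmid
    refine ⟨.cons ha (w.concat hb), fun z hz => ?_⟩
    rw [SimpleGraph.Walk.support_cons, List.mem_cons, SimpleGraph.Walk.support_concat,
      List.mem_append, List.mem_singleton] at hz
    simp only [Finset.mem_union, Finset.mem_insert, Finset.mem_singleton]
    rcases hz with hz | hz | hz
    · exact Or.inr (Or.inl hz)
    · exact Or.inl (hw z hz)
    · exact Or.inr (Or.inr hz)

end OneFiber

/-! ### Counting permutations with restricted values -/

section Permutations

variable {α ι : Type*} [Fintype α] [DecidableEq α]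

/-- If `P` does not constrain the values outside `A`, then the value at a point `a ∉ A` is
equidistributed with the values at the other points outside `A`. -/
lemma card_compl_mul_card_filter_perm {P : Finset (Equiv.Perm α)} {A : Finset α} {a : α}
    (hP : ∀ ρ ∈ P, ∀ x ∉ A, ρ * Equiv.swap a x ∈ P) (C : Finset α) :
    Aᶜ.card * (P.filter fun ρ => ρ a ∈ C).card = ∑ ρ ∈ P, (Aᶜ.filter fun x => ρ x ∈ C).card := by
  have h : ∀ x ∈ Aᶜ, (P.filter fun ρ => ρ a ∈ C).card = (P.filter fun ρ => ρ x ∈ C).card := by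
    intro x hx
    rw [Finset.mem_compl] at hx
    refine Finset.card_bij' (fun ρ _ => ρ * Equiv.swap a x) (fun ρ _ => ρ * Equiv.swap a x)
      ?_ ?_ ?_ ?_
    · intro ρ hρ
      rw [Finset.mem_filter] at hρ ⊢
      exact ⟨hP ρ hρ.1 x hx, by simpa using hρ.2⟩
    · intro ρ hρ
      rw [Finset.mem_filter] at hρ ⊢
      exact ⟨hP ρ hρ.1 x hx, by simpa using hρ.2⟩
    · intro ρ _
      simp [mul_assoc]
    · intro ρ _
      simp [mul_assoc]
  rw [← smul_eq_mul, ← Finset.sum_const, Finset.sum_congr rfl h]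
  simp_rw [Finset.card_filter]
  exact Finset.sum_comm

lemma card_perm_forall_mem_le (A C : Finset α) :
    ((Finset.univ.filter fun ρ : Equiv.Perm α => ∀ a ∈ A, ρ a ∈ C).card : ℝ) ≤
      ((C.card : ℝ) / Fintype.card α) ^ A.card * (Fintype.card α).factorial := by
  induction A using Finset.induction_on with
  | empty => simp [Fintype.card_perm]
  | insert a A ha ih =>
    set P := Finset.univ.filter fun ρ : Equiv.Perm α => ∀ x ∈ A, ρ x ∈ C with hP
    have hsplit : (Finset.univ.filter fun ρ : Equiv.Perm α => ∀ x ∈ insert a A, ρ x ∈ C) =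
        P.filter fun ρ => ρ a ∈ C := by
      ext ρ
      simp [hP, and_comm]
    have havg := card_compl_mul_card_filter_perm (P := P) (A := A) (a := a) (fun ρ hρ x hx => by
      rw [hP, Finset.mem_filter] at hρ ⊢
      refine ⟨Finset.mem_univ _, fun y hy => ?_⟩
      rw [Equiv.Perm.mul_apply, Equiv.swap_apply_of_ne_of_ne]
      · exact hρ.2 y hy
      · rintro rfl
        exact ha hy
      · rintro rfl
        exact hx hy) C
    have hsum : ∀ ρ ∈ P, (Aᶜ.filter fun x => ρ x ∈ C).card + A.card = C.card := by
      intro ρ hρ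
      rw [hP, Finset.mem_filter] at hρ
      have h1 : (Aᶜ.filter fun x => ρ x ∈ C) ∪ A = C.map ρ.symm.toEmbedding := by
        ext x
        simp only [Finset.mem_union, Finset.mem_filter, Finset.mem_compl, Finset.mem_map_equiv,
          Equiv.symm_symm]
        have := hρ.2 x
        tauto
      rw [← Finset.card_union_of_disjoint, h1, Finset.card_map]
      rw [Finset.disjoint_left]
      intro x hx
      exact Finset.mem_compl.1 (Finset.mem_filter.1 hx).1
    have hcompl : (Aᶜ.card : ℝ) = Fintype.card α - A.card := by
      rw [Finset.card_compl, Nat.cast_sub (Finset.card_le_univ A)]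
    have havg' : ((Fintype.card α : ℝ) - A.card) * (P.filter fun ρ => ρ a ∈ C).card =
        P.card * ((C.card : ℝ) - A.card) := by
      rw [← hcompl]
      have : (∑ ρ ∈ P, (((Aᶜ.filter fun x => ρ x ∈ C).card : ℕ) : ℝ)) =
          ∑ ρ ∈ P, ((C.card : ℝ) - A.card) :=
        Finset.sum_congr rfl fun ρ hρ => by rw [← hsum ρ hρ]; push_cast; ring
      rw [Finset.sum_const, nsmul_eq_mul] at this
      rw [← this]
      exact_mod_cast havg
    have hlt : (A.card : ℝ) < Fintype.card α := by
      exact_mod_cast Finset.card_lt_univ_of_notMem ha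
    have hC : (C.card : ℝ) ≤ Fintype.card α := by exact_mod_cast Finset.card_le_univ C
    have hstep : ((P.filter fun ρ => ρ a ∈ C).card : ℝ) ≤
        (C.card : ℝ) / Fintype.card α * P.card := by
      have hα : (0 : ℝ) < Fintype.card α := lt_of_le_of_lt (Nat.cast_nonneg _) hlt
      rw [div_mul_eq_mul_div, le_div_iff₀ hα]
      have hp : (0 : ℝ) ≤ P.card * (A.card * (Fintype.card α - C.card)) := by
        have := sub_nonneg.2 hC
        positivity
      have : ((Fintype.card α : ℝ) - A.card) * (((P.filter fun ρ => ρ a ∈ C).card : ℝ) *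
          Fintype.card α) ≤ ((Fintype.card α : ℝ) - A.card) * (C.card * P.card) := by
        linear_combination (Fintype.card α : ℝ) * havg' + hp
      exact le_of_mul_le_mul_left this (by linarith)
    rw [hsplit, Finset.card_insert_of_notMem ha, pow_succ]
    calc _ ≤ (C.card : ℝ) / Fintype.card α * P.card := hstep
      _ ≤ (C.card : ℝ) / Fintype.card α * (((C.card : ℝ) / Fintype.card α) ^ A.card *
          (Fintype.card α).factorial) := by gcongr
      _ = _ := by ring

/-- Sequentially avoiding sets of values. -/
lemma card_perm_forall_notMem_le {t : ℕ} {f : ι → α} (H : ι → Finset α) (I : Finset ι)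
    (hf : Set.InjOn f I) (hI : I.card ≤ t) :
    ((Finset.univ.filter fun ρ : Equiv.Perm α => ∀ i ∈ I, ρ (f i) ∉ H i).card : ℝ) ≤
      Real.exp (-((∑ i ∈ I, (((H i).card : ℝ) - t)) / Fintype.card α)) *
        (Fintype.card α).factorial := by
  classical
  induction I using Finset.induction_on with
  | empty => simp [Fintype.card_perm]
  | insert i I hi ih =>
    set P := Finset.univ.filter fun ρ : Equiv.Perm α => ∀ x ∈ I, ρ (f x) ∉ H x with hP
    have hfi : f i ∉ I.image f := by
      intro h
      obtain ⟨j, hj, hji⟩ := Finset.mem_image.1 h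
      rw [hf (by simp [hj]) (by simp) hji] at hj
      exact hi hj
    have hsplit : (Finset.univ.filter fun ρ : Equiv.Perm α => ∀ x ∈ insert i I, ρ (f x) ∉ H x) =
        P.filter fun ρ => ¬ ρ (f i) ∈ H i := by
      ext ρ
      simp [hP, and_comm]
    have havg := card_compl_mul_card_filter_perm (P := P) (A := I.image f) (a := f i)
      (fun ρ hρ x hx => by
        rw [hP, Finset.mem_filter] at hρ ⊢
        refine ⟨Finset.mem_univ _, fun y hy => ?_⟩
        rw [Equiv.Perm.mul_apply, Equiv.swap_apply_of_ne_of_ne]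
        · exact hρ.2 y hy
        · intro h
          exact hfi (h ▸ Finset.mem_image_of_mem f hy)
        · rintro rfl
          exact hx (Finset.mem_image_of_mem f hy)) (H i)
    have hIt : I.card + 1 ≤ t := by rwa [Finset.card_insert_of_notMem hi] at hI
    have hsum : ∀ ρ ∈ P, ((H i).card : ℝ) - t ≤
        (((I.image f)ᶜ.filter fun x => ρ x ∈ H i).card : ℝ) := by
      intro ρ _
      have h1 : (H i).map ρ.symm.toEmbedding ⊆
          ((I.image f)ᶜ.filter fun x => ρ x ∈ H i) ∪ I.image f := by
        intro x
        simp only [Finset.mem_union, Finset.mem_filter, Finset.mem_compl, Finset.mem_map_equiv,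
          Equiv.symm_symm]
        tauto
      have h2 := (Finset.card_le_card h1).trans (Finset.card_union_le _ _)
      rw [Finset.card_map] at h2
      have h3 : (I.image f).card ≤ I.card := Finset.card_image_le
      have h4 : (H i).card ≤ ((I.image f)ᶜ.filter fun x => ρ x ∈ H i).card + t := by omega
      rw [sub_le_iff_le_add]
      exact_mod_cast h4
    have hα : (0 : ℝ) < Fintype.card α := by
      exact_mod_cast Fintype.card_pos_iff.2 ⟨f i⟩
    have hlow : (((H i).card : ℝ) - t) / Fintype.card α * P.card ≤
        (P.filter fun ρ => ρ (f i) ∈ H i).card := by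
      rw [div_mul_eq_mul_div, div_le_iff₀ hα]
      calc (((H i).card : ℝ) - t) * P.card = ∑ ρ ∈ P, (((H i).card : ℝ) - t) := by
            rw [Finset.sum_const, nsmul_eq_mul, mul_comm]
        _ ≤ ∑ ρ ∈ P, (((I.image f)ᶜ.filter fun x => ρ x ∈ H i).card : ℝ) :=
            Finset.sum_le_sum hsum
        _ = ((I.image f)ᶜ.card : ℝ) * (P.filter fun ρ => ρ (f i) ∈ H i).card := by
            exact_mod_cast havg.symm
        _ ≤ _ := by
            rw [mul_comm]
            gcongr
            exact Finset.card_le_univ _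
    have hcompl : ((P.filter fun ρ => ¬ ρ (f i) ∈ H i).card : ℝ) =
        P.card - (P.filter fun ρ => ρ (f i) ∈ H i).card := by
      rw [← Finset.card_filter_add_card_filter_not (s := P) (fun ρ => ρ (f i) ∈ H i)]
      push_cast
      ring
    have ih' := ih (hf.mono (by simp)) (by omega)
    rw [hsplit, hcompl, Finset.sum_insert hi, add_div, neg_add, Real.exp_add, mul_assoc]
    calc _ ≤ (1 - (((H i).card : ℝ) - t) / Fintype.card α) * P.card := by linarith
      _ ≤ Real.exp (-((((H i).card : ℝ) - t) / Fintype.card α)) * P.card := by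
          gcongr
          linarith [Real.add_one_le_exp (-((((H i).card : ℝ) - t) / Fintype.card α))]
      _ ≤ _ := by gcongr

end Permutations

/-! ### Union bounds over random lifts -/

section RandomLift

variable {n ℓ : ℕ} [NeZero n]

lemma sum_sum_ite_lt_eq_sum_offDiag (x : Fin n → Fin n → ℝ) :
    ∑ j ∈ Finset.univ.erase (0 : Fin n), ∑ k, (if j < k then (x j k + x k j) / 2 else 0) =
      (∑ p ∈ (Finset.univ.erase (0 : Fin n)).offDiag, x p.1 p.2) / 2 := by
  have h1 : ∑ j ∈ Finset.univ.erase (0 : Fin n), ∑ k, (if j < k then (x j k + x k j) / 2 else 0) =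
      ∑ j ∈ Finset.univ.erase (0 : Fin n), ∑ k ∈ Finset.univ.erase (0 : Fin n),
        (if j < k then (x j k + x k j) / 2 else 0) := by
    refine Finset.sum_congr rfl fun j _ => (Finset.sum_erase _ ?_).symm
    simp
  have h2 : ∀ f : Fin n → Fin n → ℝ, ∑ j ∈ Finset.univ.erase (0 : Fin n),
      ∑ k ∈ Finset.univ.erase (0 : Fin n), (if j ≠ k then f j k else 0) =
        ∑ p ∈ (Finset.univ.erase (0 : Fin n)).offDiag, f p.1 p.2 := by
    intro f
    rw [← Finset.sum_product', ← Finset.sum_filter]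
    refine Finset.sum_congr ?_ fun _ _ => rfl
    ext p
    simp [Finset.mem_offDiag, and_assoc]
  rw [h1, ← h2]
  have h3 : ∀ j k, (if j < k then (x j k + x k j) / 2 else 0) =
      (if j < k then x j k else 0) / 2 + (if j < k then x k j else 0) / 2 := fun j k => by
    split_ifs <;> ring
  have h4 : ∀ j k, (if j ≠ k then x j k else 0) =
      (if j < k then x j k else 0) + (if k < j then x j k else 0) := by
    intro j k
    rcases lt_trichotomy j k with h | h | h
    · simp [h, h.ne, h.not_gt]
    · simp [h]
    · simp [h, h.ne', h.not_gt]
  simp_rw [h3, h4, Finset.sum_add_distrib, add_div, Finset.sum_div]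
  congr 1
  exact Finset.sum_comm

open scoped Classical in
/-- Constraints on the individual permutations outside the fiber of `0` combine independently;
each permutation is constrained from both of its ends, hence the factor `1 / 2`. -/
lemma card_fiberPerm_mem_le (τ : Fin n → Equiv.Perm (Fin ℓ))
    (E : Fin n → Fin n → Finset (Equiv.Perm (Fin ℓ))) (x : Fin n → Fin n → ℝ)
    (hE : ∀ j k, j ≠ 0 → k ≠ 0 → j ≠ k →
      ((E j k).card : ℝ) ≤ Real.exp (-x j k) * ℓ.factorial) :
    ((Finset.univ.filter fun σ : Fin n → Fin n → Equiv.Perm (Fin ℓ) => σ 0 = τ ∧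
        ∀ j k, j ≠ 0 → k ≠ 0 → j ≠ k → fiberPerm σ j k ∈ E j k).card : ℝ) ≤
      Real.exp (-(∑ p ∈ (Finset.univ.erase (0 : Fin n)).offDiag, x p.1 p.2) / 2) *
        (ℓ.factorial : ℝ) ^ (n * (n - 1)) := by
  set F : Fin n → Fin n → Finset (Equiv.Perm (Fin ℓ)) := fun j k =>
    if j = 0 then {τ k} else if j < k then (E j k).filter fun ρ => ρ⁻¹ ∈ E k j else Finset.univ
    with hF
  set y : Fin n → Fin n → ℝ := fun j k => if j < k then (x j k + x k j) / 2 else 0 with hy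
  have hsub : (Finset.univ.filter fun σ : Fin n → Fin n → Equiv.Perm (Fin ℓ) => σ 0 = τ ∧
      ∀ j k, j ≠ 0 → k ≠ 0 → j ≠ k → fiberPerm σ j k ∈ E j k) ⊆
      Fintype.piFinset fun j => Fintype.piFinset (F j) := by
    intro σ hσ
    obtain ⟨-, h0, h⟩ := Finset.mem_filter.1 hσ
    simp only [Fintype.mem_piFinset, hF]
    intro j k
    split_ifs with hj hjk
    · rw [hj, h0, Finset.mem_singleton]
    · have hk : k ≠ 0 := fun hk => by
        rw [hk] at hjk
        exact Fin.not_lt_zero _ hjk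
      have h1 := h j k hj hk hjk.ne
      have h2 := h k j hk hj hjk.ne'
      rw [← fiberPerm_inv hjk.ne] at h2
      rw [fiberPerm, if_pos hjk] at h1 h2
      exact Finset.mem_filter.2 ⟨h1, h2⟩
    · exact Finset.mem_univ _
  have hF0 : ∀ k, ((F 0 k).card : ℝ) = 1 := fun k => by simp [hF]
  have hFj : ∀ j ≠ 0, ∀ k, ((F j k).card : ℝ) ≤ Real.exp (-y j k) * ℓ.factorial := by
    intro j hj k
    simp only [hF, hy, if_neg hj]
    split_ifs with hjk
    · have hk : k ≠ 0 := fun hk => by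
        rw [hk] at hjk
        exact Fin.not_lt_zero _ hjk
      have h1 : (((E j k).filter fun ρ => ρ⁻¹ ∈ E k j).card : ℝ) ≤ (E j k).card := by
        exact_mod_cast Finset.card_le_card (Finset.filter_subset _ _)
      have h2 : (((E j k).filter fun ρ => ρ⁻¹ ∈ E k j).card : ℝ) ≤ (E k j).card := by
        exact_mod_cast Finset.card_le_card_of_injOn (fun ρ => ρ⁻¹)
          (fun ρ hρ => (Finset.mem_filter.1 hρ).2) inv_injective.injOn
      rcases le_total (x j k) (x k j) with hle | hle
      · refine (h2.trans (hE k j hk hj hjk.ne')).trans ?_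
        gcongr
        linarith
      · refine (h1.trans (hE j k hj hk hjk.ne)).trans ?_
        gcongr
        linarith
    · simp [Fintype.card_perm]
  calc _ ≤ ((Fintype.piFinset fun j => Fintype.piFinset (F j)).card : ℝ) := by
        exact_mod_cast Finset.card_le_card hsub
    _ = ∏ j ∈ Finset.univ.erase (0 : Fin n), ∏ k, ((F j k).card : ℝ) := by
        simp_rw [Fintype.card_piFinset]
        push_cast
        rw [← Finset.mul_prod_erase _ _ (Finset.mem_univ (0 : Fin n))]
        rw [Finset.prod_eq_one fun k _ => hF0 k, one_mul]
    _ ≤ ∏ j ∈ Finset.univ.erase (0 : Fin n), ∏ k, Real.exp (-y j k) * ℓ.factorial :=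
        Finset.prod_le_prod (fun _ _ => Finset.prod_nonneg fun _ _ => Nat.cast_nonneg _)
          fun j hj => Finset.prod_le_prod (fun _ _ => Nat.cast_nonneg _) fun k _ =>
            hFj j (Finset.ne_of_mem_erase hj) k
    _ = _ := by
        have h : ∀ j, ∏ k, Real.exp (-y j k) * (ℓ.factorial : ℝ) =
            Real.exp (-∑ k, y j k) * (ℓ.factorial : ℝ) ^ n := fun j => by
          rw [Finset.prod_mul_distrib, ← Real.exp_sum, Finset.sum_neg_distrib, Finset.prod_const,
            Finset.card_univ, Fintype.card_fin]
        rw [Finset.prod_congr rfl fun j _ => h j, Finset.prod_mul_distrib, ← Real.exp_sum,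
          Finset.sum_neg_distrib, sum_sum_ite_lt_eq_sum_offDiag, Finset.prod_const, ← pow_mul,
          Finset.card_erase_of_mem (Finset.mem_univ _), Finset.card_univ, Fintype.card_fin,
          neg_div]

open scoped Classical in
lemma card_lifts_le {κ : Type*} (K : Finset κ)
    (E : κ → (Fin n → Equiv.Perm (Fin ℓ)) → Fin n → Fin n → Finset (Equiv.Perm (Fin ℓ)))
    (x : κ → (Fin n → Equiv.Perm (Fin ℓ)) → Fin n → Fin n → ℝ) (b : κ → ℝ)
    (hE : ∀ c ∈ K, ∀ τ j k, j ≠ 0 → k ≠ 0 → j ≠ k →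
      ((E c τ j k).card : ℝ) ≤ Real.exp (-x c τ j k) * ℓ.factorial)
    (hx : ∀ c ∈ K, ∀ τ, b c ≤ ∑ p ∈ (Finset.univ.erase (0 : Fin n)).offDiag, x c τ p.1 p.2)
    (S : Finset (Fin n → Fin n → Equiv.Perm (Fin ℓ)))
    (hS : ∀ σ ∈ S, ∃ c ∈ K, ∀ j k, j ≠ 0 → k ≠ 0 → j ≠ k → fiberPerm σ j k ∈ E c (σ 0) j k) :
    (S.card : ℝ) ≤ (∑ c ∈ K, Real.exp (-b c / 2)) *
      Fintype.card (Fin n → Fin n → Equiv.Perm (Fin ℓ)) := by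
  have hcard : (Fintype.card (Fin n → Fin n → Equiv.Perm (Fin ℓ)) : ℝ) =
      Fintype.card (Fin n → Equiv.Perm (Fin ℓ)) * (ℓ.factorial : ℝ) ^ (n * (n - 1)) := by
    obtain ⟨m, rfl⟩ := Nat.exists_eq_succ_of_ne_zero (NeZero.ne n)
    simp only [Fintype.card_pi, Fintype.card_perm, Fintype.card_fin, Finset.prod_const,
      Finset.card_univ]
    push_cast
    rw [← pow_mul, ← pow_add]
    congr 1
    simp
    ring
  have hτ : ∀ τ : Fin n → Equiv.Perm (Fin ℓ), ((S.filter fun σ => σ 0 = τ).card : ℝ) ≤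
      (∑ c ∈ K, Real.exp (-b c / 2)) * (ℓ.factorial : ℝ) ^ (n * (n - 1)) := by
    intro τ
    have hsub : (S.filter fun σ => σ 0 = τ) ⊆ K.biUnion fun c => Finset.univ.filter fun σ =>
        σ 0 = τ ∧ ∀ j k, j ≠ 0 → k ≠ 0 → j ≠ k → fiberPerm σ j k ∈ E c τ j k := by
      intro σ hσ
      obtain ⟨hσS, rfl⟩ := Finset.mem_filter.1 hσ
      obtain ⟨c, hc, h⟩ := hS σ hσS
      exact Finset.mem_biUnion.2 ⟨c, hc, Finset.mem_filter.2 ⟨Finset.mem_univ _, rfl, h⟩⟩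
    calc ((S.filter fun σ => σ 0 = τ).card : ℝ) ≤ ∑ c ∈ K, ((Finset.univ.filter fun σ :
          Fin n → Fin n → Equiv.Perm (Fin ℓ) => σ 0 = τ ∧
            ∀ j k, j ≠ 0 → k ≠ 0 → j ≠ k → fiberPerm σ j k ∈ E c τ j k).card : ℝ) := by
          exact_mod_cast (Finset.card_le_card hsub).trans Finset.card_biUnion_le
      _ ≤ ∑ c ∈ K, Real.exp (-b c / 2) * (ℓ.factorial : ℝ) ^ (n * (n - 1)) := by
          refine Finset.sum_le_sum fun c hc => ?_
          refine (card_fiberPerm_mem_le τ (E c τ) (x c τ) (hE c hc τ)).trans ?_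
          gcongr
          exact hx c hc τ
      _ = _ := by rw [Finset.sum_mul]
  rw [Finset.card_eq_sum_card_fiberwise (f := fun σ => σ 0) (t := Finset.univ) (by simp), hcard]
  push_cast
  calc _ ≤ ∑ _τ : Fin n → Equiv.Perm (Fin ℓ), (∑ c ∈ K, Real.exp (-b c / 2)) *
        (ℓ.factorial : ℝ) ^ (n * (n - 1)) := Finset.sum_le_sum fun τ _ => hτ τ
    _ = _ := by
        rw [Finset.sum_const, nsmul_eq_mul, Finset.card_univ]
        ring

end RandomLift

/-! ### The three properties of a random lift -/

section BadEvents

variable {n ℓ : ℕ}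

lemma sum_offDiag_eq_sub {ι : Type*} [DecidableEq ι] (s : Finset ι) (f : ι → ι → ℝ) :
    ∑ p ∈ s.offDiag, f p.1 p.2 = ∑ j ∈ s, ∑ k ∈ s, f j k - ∑ j ∈ s, f j j := by
  rw [← Finset.sum_product', ← Finset.diag_union_offDiag,
    Finset.sum_union (Finset.disjoint_diag_offDiag s), Finset.sum_diag]
  ring

/-- The part of a set of vertices in the fiber of `j`. -/
def fiberPart (B : Finset (Fin n × Fin ℓ)) (j : Fin n) : Finset (Fin ℓ) :=
  Finset.univ.filter fun a => (j, a) ∈ B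

lemma mem_fiberPart {B : Finset (Fin n × Fin ℓ)} {j : Fin n} {a : Fin ℓ} :
    a ∈ fiberPart B j ↔ (j, a) ∈ B := by
  simp [fiberPart]

lemma sum_card_fiberPart (B : Finset (Fin n × Fin ℓ)) : ∑ j, (fiberPart B j).card = B.card := by
  rw [Finset.card_eq_sum_card_fiberwise (f := Prod.fst) (t := Finset.univ) (by simp)]
  refine Finset.sum_congr rfl fun j _ => ?_
  refine Finset.card_bij (fun a _ => (j, a)) ?_ ?_ ?_
  · intro a ha
    simpa using mem_fiberPart.1 ha
  · intro a _ b _ h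
    exact (Prod.ext_iff.1 h).2
  · rintro ⟨i, a⟩ h
    obtain ⟨h1, rfl⟩ := Finset.mem_filter.1 h
    exact ⟨a, mem_fiberPart.2 h1, rfl⟩

variable [NeZero n]

lemma fiberPart_zero {B : Finset (Fin n × Fin ℓ)} (hB : ∀ x ∈ B, x.1 ≠ 0) :
    fiberPart B 0 = ∅ := by
  refine Finset.eq_empty_of_forall_notMem fun a ha => ?_
  exact hB _ (mem_fiberPart.1 ha) rfl

lemma sum_card_fiberPart_erase {B : Finset (Fin n × Fin ℓ)} (hB : ∀ x ∈ B, x.1 ≠ 0) :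
    ∑ j ∈ Finset.univ.erase (0 : Fin n), ((fiberPart B j).card : ℝ) = B.card := by
  rw [← sum_card_fiberPart B, Finset.sum_erase _ (by simp [fiberPart_zero hB])]
  push_cast
  rfl

open scoped Classical in
/-- Most lifts have an edge between any two large sets of vertices. -/
lemma card_exists_not_adj_le (M : ℕ) (hℓ : 1 ≤ ℓ) :
    ((Finset.univ.filter fun σ : Fin n → Fin n → Equiv.Perm (Fin ℓ) =>
      ¬ ∀ B C : Finset (Fin n × Fin ℓ), (∀ x ∈ B, x.1 ≠ 0) → (∀ x ∈ C, x.1 ≠ 0) →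
        M ≤ B.card → M ≤ C.card → ∃ x ∈ B, ∃ y ∈ C, (liftGraph n ℓ σ).Adj x y).card : ℝ) ≤
      4 ^ (n * ℓ) * Real.exp (-(((M : ℝ) ^ 2 - ℓ * M) / ℓ) / 2) *
        Fintype.card (Fin n → Fin n → Equiv.Perm (Fin ℓ)) := by
  set S := Finset.univ.filter fun σ : Fin n → Fin n → Equiv.Perm (Fin ℓ) =>
    ¬ ∀ B C : Finset (Fin n × Fin ℓ), (∀ x ∈ B, x.1 ≠ 0) → (∀ x ∈ C, x.1 ≠ 0) →
      M ≤ B.card → M ≤ C.card → ∃ x ∈ B, ∃ y ∈ C, (liftGraph n ℓ σ).Adj x y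
  set V := Fin n × Fin ℓ
  set K : Finset (Finset V × Finset V) := Finset.univ.filter fun c =>
    ((∀ x ∈ c.1, x.1 ≠ 0) ∧ ∀ x ∈ c.2, x.1 ≠ 0) ∧ c.1.card = M ∧ c.2.card = M with hK
  have hℓ0 : (0 : ℝ) < ℓ := by exact_mod_cast hℓ
  have hE : ∀ c ∈ K, ∀ (_ : Fin n → Equiv.Perm (Fin ℓ)) (j k : Fin n), j ≠ 0 → k ≠ 0 → j ≠ k →
      ((Finset.univ.filter fun ρ : Equiv.Perm (Fin ℓ) =>
        ∀ a ∈ fiberPart c.1 j, ρ a ∈ (fiberPart c.2 k)ᶜ).card : ℝ) ≤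
      Real.exp (-((fiberPart c.1 j).card * (fiberPart c.2 k).card / ℓ)) * ℓ.factorial := by
    intro c _ τ j k _ _ _
    have h := card_perm_forall_mem_le (fiberPart c.1 j) (fiberPart c.2 k)ᶜ
    refine le_trans (le_of_eq ?_) (h.trans ?_)
    · congr!
    rw [Fintype.card_fin]
    gcongr
    calc _ ≤ Real.exp (-((fiberPart c.2 k).card / ℓ)) ^ (fiberPart c.1 j).card := by
          gcongr
          rw [Finset.card_compl, Fintype.card_fin, Nat.cast_sub (by
            simpa using Finset.card_le_univ (fiberPart c.2 k)), sub_div, div_self hℓ0.ne']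
          linarith [Real.add_one_le_exp (-((fiberPart c.2 k).card / (ℓ : ℝ)))]
      _ = _ := by
          rw [← Real.exp_nat_mul]
          congr 1
          ring
  have hx : ∀ c ∈ K, ∀ _ : Fin n → Equiv.Perm (Fin ℓ), ((M : ℝ) ^ 2 - ℓ * M) / ℓ ≤
      ∑ p ∈ (Finset.univ.erase (0 : Fin n)).offDiag,
        ((fiberPart c.1 p.1).card * (fiberPart c.2 p.2).card / ℓ : ℝ) := by
    intro c hc τ
    obtain ⟨-, ⟨h1, h2⟩, h3, h4⟩ := Finset.mem_filter.1 hc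
    rw [sum_offDiag_eq_sub _ fun j k =>
      ((fiberPart c.1 j).card * (fiberPart c.2 k).card / ℓ : ℝ), ← Finset.sum_div]
    have hfull : ∑ j ∈ Finset.univ.erase (0 : Fin n), ∑ k ∈ Finset.univ.erase (0 : Fin n),
        ((fiberPart c.1 j).card * (fiberPart c.2 k).card / ℓ : ℝ) = (M : ℝ) ^ 2 / ℓ := by
      simp_rw [mul_div_assoc]
      rw [← Finset.sum_mul_sum, ← Finset.sum_div, sum_card_fiberPart_erase h1,
        sum_card_fiberPart_erase h2, h3, h4]
      ring
    have hdiag : ∑ j ∈ Finset.univ.erase (0 : Fin n),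
        ((fiberPart c.1 j).card * (fiberPart c.2 j).card : ℝ) ≤ ℓ * M := by
      rw [← h3, ← sum_card_fiberPart_erase h1, Finset.mul_sum]
      refine Finset.sum_le_sum fun j _ => ?_
      rw [mul_comm]
      gcongr
      simpa using Finset.card_le_univ (fiberPart c.2 j)
    rw [hfull, sub_div]
    gcongr
  have hS : ∀ σ ∈ S, ∃ c ∈ K, ∀ j k, j ≠ 0 → k ≠ 0 → j ≠ k →
      fiberPerm σ j k ∈ Finset.univ.filter fun ρ : Equiv.Perm (Fin ℓ) =>
        ∀ a ∈ fiberPart c.1 j, ρ a ∈ (fiberPart c.2 k)ᶜ := by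
    intro σ hσ
    have hσ := (Finset.mem_filter.1 hσ).2
    push Not at hσ
    obtain ⟨B, C, hB, hC, hBM, hCM, h⟩ := hσ
    obtain ⟨B', hB', hB'M⟩ := Finset.exists_subset_card_eq hBM
    obtain ⟨C', hC', hC'M⟩ := Finset.exists_subset_card_eq hCM
    refine ⟨(B', C'), Finset.mem_filter.2 ⟨Finset.mem_univ _, ⟨fun x hx => hB x (hB' hx),
      fun x hx => hC x (hC' hx)⟩, hB'M, hC'M⟩, fun j k _ _ hjk => ?_⟩
    refine Finset.mem_filter.2 ⟨Finset.mem_univ _, fun a ha => ?_⟩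
    rw [Finset.mem_compl, mem_fiberPart]
    intro hk
    exact h _ (hB' (mem_fiberPart.1 ha)) _ (hC' hk) (liftGraph_adj.2 ⟨hjk, rfl⟩)
  refine (card_lifts_le K (fun c _ j k => _) (fun c _ j k => _)
    (fun _ => ((M : ℝ) ^ 2 - ℓ * M) / ℓ) hE hx S hS).trans ?_
  rw [Finset.sum_const, nsmul_eq_mul]
  gcongr
  have : K.card ≤ 4 ^ (n * ℓ) := by
    refine (Finset.card_le_univ K).trans (le_of_eq ?_)
    simp only [V, Fintype.card_prod, Fintype.card_finset, Fintype.card_fin]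
    rw [← mul_pow]
    norm_num
  exact_mod_cast this

open scoped Classical in
/-- Most lifts have edges between the neighbours of the first `n` vertices of a fiber, for any
large family of candidates. -/
lemma card_exists_not_starAdj_le (hℓ : n ≤ ℓ) {s t : ℕ} (hs : 1 ≤ s) :
    ((Finset.univ.filter fun σ : Fin n → Fin n → Equiv.Perm (Fin ℓ) =>
      ¬ ∀ (T : Finset (Fin n)) (R U : Fin n → Finset (Fin n)), T.card = t →
      (∀ a, 0 ∉ U a) → (∀ a ∈ T, a ∉ R a ∧ s ≤ (R a).card ∧ s ≤ (U a).card ∧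
        ∀ b ∈ R a, s ≤ (U b).card) →
      ∃ a ∈ T, ∃ b ∈ R a, ∃ j ∈ U a, ∃ k ∈ U b, StarAdj hℓ σ (j, a) (k, b)).card : ℝ) ≤
      2 ^ (3 * n ^ 2) *
        Real.exp (-(((t : ℝ) * (s * (s * (s - 1))) - (t : ℝ) ^ 2 * (n : ℝ) ^ 2) / ℓ) / 2) *
        Fintype.card (Fin n → Fin n → Equiv.Perm (Fin ℓ)) := by
  set S := Finset.univ.filter fun σ : Fin n → Fin n → Equiv.Perm (Fin ℓ) =>
    ¬ ∀ (T : Finset (Fin n)) (R U : Fin n → Finset (Fin n)), T.card = t →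
      (∀ a, 0 ∉ U a) → (∀ a ∈ T, a ∉ R a ∧ s ≤ (R a).card ∧ s ≤ (U a).card ∧
        ∀ b ∈ R a, s ≤ (U b).card) →
      ∃ a ∈ T, ∃ b ∈ R a, ∃ j ∈ U a, ∃ k ∈ U b, StarAdj hℓ σ (j, a) (k, b)
  set K : Finset (Finset (Fin n) × (Fin n → Finset (Fin n)) × (Fin n → Finset (Fin n))) :=
    Finset.univ.filter fun c => c.1.card = t ∧ (∀ a, 0 ∉ c.2.2 a) ∧
      ∀ a ∈ c.1, s ≤ (c.2.1 a).card ∧ s ≤ (c.2.2 a).card ∧ ∀ b ∈ c.2.1 a, s ≤ (c.2.2 b).card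
    with hK
  have hn : 0 < n := Nat.pos_of_ne_zero (NeZero.ne n)
  have hℓ0 : (0 : ℝ) < ℓ := by exact_mod_cast hn.trans_le hℓ
  have hs1 : (1 : ℝ) ≤ s := by exact_mod_cast hs
  have hE : ∀ c ∈ K, ∀ (τ : Fin n → Equiv.Perm (Fin ℓ)) (j k : Fin n), j ≠ 0 → k ≠ 0 → j ≠ k →
      ((Finset.univ.filter fun ρ : Equiv.Perm (Fin ℓ) => ∀ a ∈ c.1.filter fun a => j ∈ c.2.2 a,
        ρ (τ j (Fin.castLE hℓ a)) ∉ ((c.2.1 a).filter fun b => k ∈ c.2.2 b).image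
          fun b => τ k (Fin.castLE hℓ b)).card : ℝ) ≤
      Real.exp (-((∑ a ∈ c.1.filter fun a => j ∈ c.2.2 a,
        ((((c.2.1 a).filter fun b => k ∈ c.2.2 b).card : ℝ) - t)) / ℓ)) * ℓ.factorial := by
    intro c hc τ j k _ _ _
    obtain ⟨-, hT, -, -⟩ := Finset.mem_filter.1 hc
    have hinj : ∀ i, Function.Injective fun b => τ i (Fin.castLE hℓ b) := fun i =>
      (τ i).injective.comp (Fin.castLE_injective hℓ)
    have h := card_perm_forall_notMem_le (t := t)
      (fun a => ((c.2.1 a).filter fun b => k ∈ c.2.2 b).image fun b => τ k (Fin.castLE hℓ b))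
      (c.1.filter fun a => j ∈ c.2.2 a) (hinj j).injOn
      ((Finset.card_le_card (Finset.filter_subset _ _)).trans hT.le)
    refine le_trans (le_of_eq ?_) (h.trans (le_of_eq ?_))
    · congr!
    simp_rw [Finset.card_image_of_injective _ (hinj k), Fintype.card_fin]
  have hx : ∀ c ∈ K, ∀ _ : Fin n → Equiv.Perm (Fin ℓ),
      ((t : ℝ) * (s * (s * (s - 1))) - (t : ℝ) ^ 2 * (n : ℝ) ^ 2) / ℓ ≤
      ∑ p ∈ (Finset.univ.erase (0 : Fin n)).offDiag,
        (∑ a ∈ c.1.filter fun a => p.1 ∈ c.2.2 a,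
          ((((c.2.1 a).filter fun b => p.2 ∈ c.2.2 b).card : ℝ) - t)) / ℓ := by
    intro c hc τ
    obtain ⟨-, hT, hU0, hc⟩ := Finset.mem_filter.1 hc
    obtain ⟨T, R, U⟩ := c
    simp only at hT hU0 hc ⊢
    rw [← Finset.sum_div]
    refine div_le_div_of_nonneg_right ?_ hℓ0.le
    simp_rw [Finset.sum_sub_distrib]
    have hlow : ∑ p ∈ (Finset.univ.erase (0 : Fin n)).offDiag,
        ∑ _a ∈ T.filter fun a => p.1 ∈ U a, (t : ℝ) ≤ (t : ℝ) ^ 2 * (n : ℝ) ^ 2 := by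
      calc _ ≤ ∑ p ∈ (Finset.univ.erase (0 : Fin n)).offDiag, (t : ℝ) ^ 2 := by
            refine Finset.sum_le_sum fun p _ => ?_
            rw [Finset.sum_const, nsmul_eq_mul, sq]
            gcongr
            exact (Finset.card_le_card (Finset.filter_subset _ _)).trans hT.le
        _ ≤ _ := by
            rw [Finset.sum_const, nsmul_eq_mul, mul_comm]
            gcongr
            have : (Finset.univ.erase (0 : Fin n)).offDiag.card ≤ n ^ 2 := by
              refine (Finset.card_le_univ _).trans (le_of_eq ?_)
              rw [Fintype.card_prod, Fintype.card_fin, sq]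
            exact_mod_cast this
    have hmain : (t : ℝ) * (s * (s * (s - 1))) ≤ ∑ p ∈ (Finset.univ.erase (0 : Fin n)).offDiag,
        ∑ a ∈ T.filter fun a => p.1 ∈ U a, (((R a).filter fun b => p.2 ∈ U b).card : ℝ) := by
      have hind : ∀ j k : Fin n,
          ∑ a ∈ T.filter fun a => j ∈ U a, (((R a).filter fun b => k ∈ U b).card : ℝ) =
            ∑ a ∈ T, ∑ b ∈ R a, (if j ∈ U a then 1 else 0) * (if k ∈ U b then 1 else 0) := by
        intro j k
        rw [Finset.sum_filter]
        refine Finset.sum_congr rfl fun a _ => ?_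
        split_ifs
        · simp
        · simp
      have h0 : ∀ a, ∑ j ∈ Finset.univ.erase (0 : Fin n), (if j ∈ U a then (1 : ℝ) else 0) =
          (U a).card := by
        intro a
        rw [Finset.sum_erase _ (by simp [hU0])]
        simp
      rw [sum_offDiag_eq_sub _ fun j k => ∑ a ∈ T.filter fun a => j ∈ U a,
        (((R a).filter fun b => k ∈ U b).card : ℝ)]
      simp_rw [hind]
      have hfull : ∑ j ∈ Finset.univ.erase (0 : Fin n), ∑ k ∈ Finset.univ.erase (0 : Fin n),
          ∑ a ∈ T, ∑ b ∈ R a, ((if j ∈ U a then 1 else 0) * (if k ∈ U b then 1 else 0) : ℝ) =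
          ∑ a ∈ T, ∑ b ∈ R a, ((U a).card * (U b).card : ℝ) := by
        simp_rw [← h0, Finset.sum_mul_sum]
        rw [Finset.sum_congr rfl fun j _ => Finset.sum_comm, Finset.sum_comm]
        refine Finset.sum_congr rfl fun a _ => ?_
        rw [Finset.sum_congr rfl fun j _ => Finset.sum_comm, Finset.sum_comm]
      have hdiag : ∑ j ∈ Finset.univ.erase (0 : Fin n),
          ∑ a ∈ T, ∑ b ∈ R a, ((if j ∈ U a then 1 else 0) * (if j ∈ U b then 1 else 0) : ℝ) ≤
          ∑ a ∈ T, ∑ b ∈ R a, ((U a).card : ℝ) := by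
        rw [Finset.sum_comm]
        refine Finset.sum_le_sum fun a _ => ?_
        rw [Finset.sum_comm]
        refine Finset.sum_le_sum fun b _ => ?_
        rw [← h0]
        refine Finset.sum_le_sum fun j _ => ?_
        split_ifs <;> simp
      have hdiff : (t : ℝ) * (s * (s * (s - 1))) ≤
          ∑ a ∈ T, ∑ b ∈ R a, ((U a).card * ((U b).card - 1) : ℝ) := by
        rw [← hT, ← nsmul_eq_mul, ← Finset.sum_const]
        refine Finset.sum_le_sum fun a ha => ?_
        obtain ⟨h1, h2, h3⟩ := hc a ha
        calc ((s : ℝ) * (s * (s - 1))) ≤ (R a).card * (s * (s - 1)) := by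
              have : (0 : ℝ) ≤ s * (s - 1) := mul_nonneg (by linarith) (by linarith)
              gcongr
          _ = ∑ b ∈ R a, ((s : ℝ) * (s - 1)) := by rw [Finset.sum_const, nsmul_eq_mul]
          _ ≤ _ := by
              refine Finset.sum_le_sum fun b hb => ?_
              have : (s : ℝ) ≤ (U b).card := by exact_mod_cast h3 b hb
              have : (s : ℝ) ≤ (U a).card := by exact_mod_cast h2
              have : (0 : ℝ) ≤ s - 1 := by linarith
              gcongr
      rw [hfull]
      simp_rw [mul_sub, mul_one, Finset.sum_sub_distrib] at hdiff
      linarith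
    linarith
  have hS : ∀ σ ∈ S, ∃ c ∈ K, ∀ j k, j ≠ 0 → k ≠ 0 → j ≠ k →
      fiberPerm σ j k ∈ Finset.univ.filter fun ρ : Equiv.Perm (Fin ℓ) =>
        ∀ a ∈ c.1.filter fun a => j ∈ c.2.2 a,
          ρ (σ 0 j (Fin.castLE hℓ a)) ∉
            ((c.2.1 a).filter fun b => k ∈ c.2.2 b).image fun b => σ 0 k (Fin.castLE hℓ b) := by
    intro σ hσ
    have hσ := (Finset.mem_filter.1 hσ).2
    push Not at hσ
    obtain ⟨T, R, U, hT, hU0, hc, h⟩ := hσ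
    refine ⟨(T, R, U), Finset.mem_filter.2 ⟨Finset.mem_univ _, hT, hU0, fun a ha => (hc a ha).2⟩,
      fun j k _ _ hjk => Finset.mem_filter.2 ⟨Finset.mem_univ _, fun a ha hb => ?_⟩⟩
    obtain ⟨haT, haj⟩ := Finset.mem_filter.1 ha
    obtain ⟨b, hb, hbk⟩ := Finset.mem_image.1 hb
    obtain ⟨hbR, hbk'⟩ := Finset.mem_filter.1 hb
    exact h a haT b hbR j haj k hbk' (liftGraph_adj.2 ⟨hjk, hbk.symm⟩)
  refine (card_lifts_le K (fun c τ j k => _) (fun c τ j k => _)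
    (fun _ => ((t : ℝ) * (s * (s * (s - 1))) - (t : ℝ) ^ 2 * (n : ℝ) ^ 2) / ℓ)
    hE hx S hS).trans ?_
  rw [Finset.sum_const, nsmul_eq_mul]
  gcongr
  have : K.card ≤ 2 ^ (3 * n ^ 2) := by
    refine (Finset.card_le_univ K).trans ?_
    simp only [Fintype.card_prod, Fintype.card_finset, Fintype.card_fin, Fintype.card_pi,
      Finset.prod_const, Finset.card_univ]
    rw [← pow_mul, ← pow_add, ← pow_add]
    refine Nat.pow_le_pow_right (by norm_num) ?_
    nlinarith
  exact_mod_cast this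

end BadEvents

section Expansion

variable {n ℓ : ℕ} [NeZero n]

open scoped Classical in
lemma card_exists_nbhd_lt_of_card_eq (hℓ : n ≤ ℓ) {x : ℕ} (hx : 1 ≤ x) (hxn : 2 * x ≤ n * ℓ)
    (hn : 8 ≤ n) {y : ℝ} (hy : 0 ≤ y)
    (hxy : 8 * (x : ℝ) / (n * ℓ) + n / ℓ ≤ Real.exp (-y)) :
    ((Finset.univ.filter fun σ : Fin n → Fin n → Equiv.Perm (Fin ℓ) =>
      ∃ U : Finset (Fin n × Fin ℓ), (∀ v ∈ U, v.1 ≠ 0) ∧ U.card = x ∧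
        (nbhd (liftGraph n ℓ σ) U (freeVertices hℓ σ)).card < 2 * x).card : ℝ) ≤
      (n * ℓ).choose x * (n * ℓ).choose (2 * x) * Real.exp (-(x * (n / 2) * y) / 2) *
        Fintype.card (Fin n → Fin n → Equiv.Perm (Fin ℓ)) := by
  set S := Finset.univ.filter fun σ : Fin n → Fin n → Equiv.Perm (Fin ℓ) =>
    ∃ U : Finset (Fin n × Fin ℓ), (∀ v ∈ U, v.1 ≠ 0) ∧ U.card = x ∧
      (nbhd (liftGraph n ℓ σ) U (freeVertices hℓ σ)).card < 2 * x
  set K : Finset (Finset (Fin n × Fin ℓ) × Finset (Fin n × Fin ℓ)) :=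
    (Finset.powersetCard x Finset.univ ×ˢ Finset.powersetCard (2 * x) Finset.univ).filter
      fun c => ∀ v ∈ c.1, v.1 ≠ 0
  have hn0 : (0 : ℝ) < n := by exact_mod_cast (by omega : 0 < n)
  have hℓ0 : (0 : ℝ) < ℓ := by exact_mod_cast (by omega : 0 < ℓ)
  have hx0 : (0 : ℝ) < x := by exact_mod_cast hx
  have hE : ∀ c ∈ K, ∀ (τ : Fin n → Equiv.Perm (Fin ℓ)) (j k : Fin n), j ≠ 0 → k ≠ 0 → j ≠ k →
      ((Finset.univ.filter fun ρ : Equiv.Perm (Fin ℓ) => ∀ a ∈ fiberPart c.1 j,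
        ρ a ∈ fiberPart c.2 k ∪ Finset.univ.image fun b : Fin n => τ k (Fin.castLE hℓ b)).card :
          ℝ) ≤
      Real.exp (-(if n * (fiberPart c.2 k).card ≤ 8 * x then (fiberPart c.1 j).card * y else 0)) *
        ℓ.factorial := by
    intro c _ τ j k _ _ _
    split_ifs with hlight
    · have h := card_perm_forall_mem_le (fiberPart c.1 j)
        (fiberPart c.2 k ∪ Finset.univ.image fun b : Fin n => τ k (Fin.castLE hℓ b))
      refine le_trans (le_of_eq ?_) (h.trans ?_)
      · congr!
      rw [Fintype.card_fin]
      gcongr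
      rw [← mul_neg, Real.exp_nat_mul]
      gcongr
      refine le_trans ?_ hxy
      have h1 : (fiberPart c.2 k ∪
          Finset.univ.image fun b : Fin n => τ k (Fin.castLE hℓ b)).card ≤
          (fiberPart c.2 k).card + n := by
        refine (Finset.card_union_le _ _).trans ?_
        gcongr
        exact Finset.card_image_le.trans (by simp)
      have h2 : ((fiberPart c.2 k).card : ℝ) ≤ 8 * x / n := by
        rw [le_div_iff₀ hn0, mul_comm]
        exact_mod_cast hlight
      rw [← div_div, ← add_div]
      gcongr
      refine le_trans (Nat.cast_le.2 h1) ?_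
      push_cast
      gcongr
    · rw [neg_zero, Real.exp_zero, one_mul]
      exact_mod_cast (Finset.card_le_univ _).trans (by rw [Fintype.card_perm, Fintype.card_fin])
  have hsum : ∀ c ∈ K, ∀ _ : Fin n → Equiv.Perm (Fin ℓ), (x : ℝ) * (n / 2) * y ≤
      ∑ p ∈ (Finset.univ.erase (0 : Fin n)).offDiag,
        (if n * (fiberPart c.2 p.2).card ≤ 8 * x then (fiberPart c.1 p.1).card * y else 0) := by
    intro c hc _
    obtain ⟨hc, hc0⟩ := Finset.mem_filter.1 hc
    obtain ⟨hcU, hcY⟩ := Finset.mem_product.1 hc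
    replace hcU := (Finset.mem_powersetCard.1 hcU).2
    replace hcY := (Finset.mem_powersetCard.1 hcY).2
    set heavy := Finset.univ.filter fun k : Fin n => ¬ n * (fiberPart c.2 k).card ≤ 8 * x
    have hheavy : 4 * heavy.card ≤ n := by
      have h1 : heavy.card * (8 * x) ≤ ∑ k ∈ heavy, n * (fiberPart c.2 k).card := by
        rw [← smul_eq_mul, ← Finset.sum_const]
        exact Finset.sum_le_sum fun k hk => (not_le.1 (Finset.mem_filter.1 hk).2).le
      have h2 : ∑ k ∈ heavy, n * (fiberPart c.2 k).card ≤ n * (2 * x) := by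
        rw [← hcY, ← sum_card_fiberPart c.2, Finset.mul_sum]
        exact Finset.sum_le_sum_of_subset (Finset.subset_univ _)
      have h3 : (4 * heavy.card) * (2 * x) ≤ n * (2 * x) := by linarith
      exact Nat.le_of_mul_le_mul_right h3 (by omega)
    set light := (Finset.univ.erase (0 : Fin n)).filter fun k => n * (fiberPart c.2 k).card ≤ 8 * x
    have hlight : n ≤ light.card + heavy.card + 1 := by
      have h1 : (Finset.univ : Finset (Fin n)) ⊆ insert 0 (light ∪ heavy) := by
        intro k _
        simp only [light, heavy, Finset.mem_insert, Finset.mem_union, Finset.mem_filter,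
          Finset.mem_erase, Finset.mem_univ, true_and, and_true]
        tauto
      have h2 := (Finset.card_le_card h1).trans (Finset.card_insert_le _ _)
      have h3 := Finset.card_union_le light heavy
      rw [Finset.card_univ, Fintype.card_fin] at h2
      omega
    have hlight' : (n : ℝ) / 2 ≤ light.card - 1 := by
      have : n + 2 ≤ 2 * light.card := by omega
      have : (n : ℝ) + 2 ≤ 2 * light.card := by exact_mod_cast this
      linarith
    rw [sum_offDiag_eq_sub _ fun j k =>
      (if n * (fiberPart c.2 k).card ≤ 8 * x then ((fiberPart c.1 j).card * y : ℝ) else 0)]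
    have hUsum := sum_card_fiberPart_erase hc0
    rw [hcU] at hUsum
    have hfull : ∑ j ∈ Finset.univ.erase (0 : Fin n), ∑ k ∈ Finset.univ.erase (0 : Fin n),
        (if n * (fiberPart c.2 k).card ≤ 8 * x then ((fiberPart c.1 j).card * y : ℝ) else 0) =
        x * (light.card * y) := by
      rw [← hUsum, Finset.sum_mul]
      refine Finset.sum_congr rfl fun j _ => ?_
      rw [← Finset.sum_filter, Finset.sum_const, nsmul_eq_mul]
      ring
    have hdiag : ∑ j ∈ Finset.univ.erase (0 : Fin n),
        (if n * (fiberPart c.2 j).card ≤ 8 * x then ((fiberPart c.1 j).card * y : ℝ) else 0) ≤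
        x * y := by
      rw [← hUsum, Finset.sum_mul]
      refine Finset.sum_le_sum fun j _ => ?_
      split_ifs
      · exact le_rfl
      · positivity
    rw [hfull]
    have : (x : ℝ) * (n / 2) * y ≤ x * (light.card - 1) * y := by gcongr
    linarith
  have hS : ∀ σ ∈ S, ∃ c ∈ K, ∀ j k, j ≠ 0 → k ≠ 0 → j ≠ k →
      fiberPerm σ j k ∈ Finset.univ.filter fun ρ : Equiv.Perm (Fin ℓ) => ∀ a ∈ fiberPart c.1 j,
        ρ a ∈ fiberPart c.2 k ∪ Finset.univ.image fun b : Fin n => σ 0 k (Fin.castLE hℓ b) := by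
    intro σ hσ
    obtain ⟨U, hU0, hUx, hU⟩ := (Finset.mem_filter.1 hσ).2
    obtain ⟨Y, hY, -, hYx⟩ := Finset.exists_subsuperset_card_eq (Finset.subset_univ _) hU.le
      (by simpa using hxn)
    refine ⟨(U, Y), Finset.mem_filter.2 ⟨Finset.mem_product.2
      ⟨Finset.mem_powersetCard.2 ⟨Finset.subset_univ _, hUx⟩,
        Finset.mem_powersetCard.2 ⟨Finset.subset_univ _, hYx⟩⟩, hU0⟩, fun j k _ hk hjk =>
          Finset.mem_filter.2 ⟨Finset.mem_univ _, fun a ha => ?_⟩⟩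
    rw [Finset.mem_union, or_iff_not_imp_right]
    intro h
    refine mem_fiberPart.2 (hY (mem_nbhd.2 ⟨Finset.mem_filter.2
      ⟨Finset.mem_univ _, hk, fun b hb => ?_⟩, (j, a), mem_fiberPart.1 ha,
       liftGraph_adj.2 ⟨hjk, rfl⟩⟩))
    exact h (Finset.mem_image.2 ⟨b, Finset.mem_univ _, hb.symm⟩)
  refine (card_lifts_le K (fun c τ j k => _) (fun c τ j k => _)
    (fun _ => (x : ℝ) * (n / 2) * y) hE hsum S hS).trans ?_
  rw [Finset.sum_const, nsmul_eq_mul]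
  gcongr
  have : K.card ≤ (n * ℓ).choose x * (n * ℓ).choose (2 * x) := by
    refine (Finset.card_le_card (Finset.filter_subset _ _)).trans (le_of_eq ?_)
    rw [Finset.card_product, Finset.card_powersetCard, Finset.card_powersetCard, Finset.card_univ,
      Fintype.card_prod, Fintype.card_fin, Fintype.card_fin]
  exact_mod_cast this

end Expansion

/-! ### Asymptotic estimates -/

section Asymptotics

lemma natCast_le_two_mul_log {k : ℕ} {x : ℝ} (h : (2 : ℝ) ^ k ≤ x) : (k : ℝ) ≤ 2 * Real.log x := by
  have h1 := Real.log_le_log (by positivity) h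
  rw [Real.log_pow] at h1
  nlinarith [Real.log_two_gt_d9, (Nat.cast_nonneg k : (0 : ℝ) ≤ k)]

lemma exists_root {n : ℕ} {Z : ℝ} {m : ℕ} (hZ : 0 ≤ Z) (hm : m ≠ 0) (h : Z ^ m ≤ n) :
    ∃ z : ℝ, Z ≤ z ∧ z ^ m = n :=
  ⟨(n : ℝ) ^ ((1 : ℝ) / m), by
    rw [one_div]
    exact (Real.le_rpow_inv_iff_of_pos hZ (Nat.cast_nonneg n) (by positivity)).2
      (by rwa [Real.rpow_natCast]), by
    rw [← Real.rpow_natCast, ← Real.rpow_mul (Nat.cast_nonneg n), one_div,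
      inv_mul_cancel₀ (by exact_mod_cast hm), Real.rpow_one]⟩

/-- The exponent in the union bound over families of candidate pairs. -/
lemma two_pow_mul_exp_le {z n ℓ s t : ℝ} (hz : 4 ≤ z) (hn : z ^ 32 = n) (hℓ0 : 0 < ℓ)
    (hℓ : ℓ ≤ z ^ 36) (hs : z ^ 30 ≤ s) (ht : z ^ 16 ≤ t) (ht2 : t ≤ 2 * z ^ 16) :
    3 * n ^ 2 + -((t * (s * (s * (s - 1))) - t ^ 2 * n ^ 2) / ℓ) / 2 ≤ -z := by
  have hz0 : 0 < z := by linarith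
  have hs0 : 0 < s := lt_of_lt_of_le (by positivity) hs
  have ht0 : 0 < t := lt_of_lt_of_le (by positivity) ht
  have h1 : z ^ 30 / 2 ≤ s - 1 := by
    have : (2 : ℝ) ≤ z ^ 30 := by
      calc (2 : ℝ) ≤ z := by linarith
        _ ≤ z ^ 30 := le_self_pow₀ (by linarith) (by norm_num)
    linarith
  have hss : z ^ 30 * (z ^ 30 * (z ^ 30 / 2)) ≤ s * (s * (s - 1)) := by gcongr
  have htn : t * n ^ 2 ≤ 2 * z ^ 16 * (z ^ 32) ^ 2 := by
    rw [hn]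
    gcongr
  have h10 : (8 : ℝ) ≤ z ^ 10 := by
    calc (8 : ℝ) ≤ 4 ^ 10 := by norm_num
      _ ≤ z ^ 10 := by gcongr
  have h80 : 0 < z ^ 80 := by positivity
  have hdiff : z ^ 90 / 4 ≤ s * (s * (s - 1)) - t * n ^ 2 := by
    have e1 : z ^ 30 * (z ^ 30 * (z ^ 30 / 2)) = z ^ 80 * z ^ 10 / 2 := by ring
    have e2 : 2 * z ^ 16 * (z ^ 32) ^ 2 = 2 * z ^ 80 := by ring
    have e3 : z ^ 90 / 4 = z ^ 80 * z ^ 10 / 4 := by ring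
    nlinarith
  have hprod : z ^ 106 / 4 ≤ t * (s * (s * (s - 1))) - t ^ 2 * n ^ 2 := by
    calc z ^ 106 / 4 = z ^ 16 * (z ^ 90 / 4) := by ring
      _ ≤ t * (s * (s * (s - 1)) - t * n ^ 2) := by gcongr
      _ = _ := by ring
  have hdiv : z ^ 70 / 4 ≤ (t * (s * (s * (s - 1))) - t ^ 2 * n ^ 2) / ℓ := by
    rw [le_div_iff₀ hℓ0]
    calc z ^ 70 / 4 * ℓ ≤ z ^ 70 / 4 * z ^ 36 := by gcongr
      _ = z ^ 106 / 4 := by ring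
      _ ≤ _ := hprod
  have hn2 : n ^ 2 = z ^ 64 := by rw [← hn]; ring
  have h6 : (32 : ℝ) ≤ z ^ 6 := by
    calc (32 : ℝ) ≤ 4 ^ 6 := by norm_num
      _ ≤ z ^ 6 := by gcongr
  have h64 : z ≤ z ^ 64 := le_self_pow₀ (by linarith) (by norm_num)
  have e4 : z ^ 70 = z ^ 64 * z ^ 6 := by ring
  have h70 := mul_le_mul_of_nonneg_left h6 (by positivity : 0 ≤ z ^ 64)
  rw [hn2] at hdiv ⊢
  linarith

end Asymptotics

section Assignments

variable {n ℓ : ℕ} [NeZero n]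

lemma starAdj_symm (hℓ : n ≤ ℓ) (σ : Fin n → Fin n → Equiv.Perm (Fin ℓ)) (x y : Fin n × Fin n)
    (h : StarAdj hℓ σ x y) : StarAdj hℓ σ y x :=
  SimpleGraph.Adj.symm h

omit [NeZero n] in
lemma card_unmatchedPairs_le {r : Fin n × Fin n → Fin n × Fin n → Prop}
    {c : Fin n → Equiv.Perm (Fin n)} : (unmatchedPairs r c).card ≤ n ^ 2 := by
  refine (Finset.card_le_univ _).trans (le_of_eq ?_)
  rw [Fintype.card_prod, Fintype.card_fin, sq]

end Assignments

/-- With high probability there is an assignment leaving only few pairs unmatched, even after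
multiplication by a logarithmic factor. -/
lemma exists_card_unmatchedPairs_le {γ δ : ℝ} (hγ : 0 < γ) (hδ : 0 < δ) :
    ∃ N : ℕ, ∀ n : ℕ, N ≤ n → ∀ [NeZero n], ∀ (ℓ : ℕ) (hℓ : n ≤ ℓ),
      ∃ S : Finset (Fin n → Fin n → Equiv.Perm (Fin ℓ)),
        (S.card : ℝ) ≤ δ * Fintype.card (Fin n → Fin n → Equiv.Perm (Fin ℓ)) ∧
        ∀ σ ∉ S, ∃ c : Fin n → Equiv.Perm (Fin n), (∀ a, c a a = 0) ∧
          ∀ k : ℕ, (2 : ℝ) ^ k ≤ 2 * (n * ℓ) →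
            2 * k * ((unmatchedPairs (StarAdj hℓ σ) c).card : ℝ) ≤ γ * (n * ℓ) := by
  classical
  set Z : ℝ := 4 + 2208 / γ + |Real.log δ| with hZ
  have hγ' : 0 < 2208 / γ := by positivity
  have hZ4 : 4 ≤ Z := by
    have := abs_nonneg (Real.log δ)
    linarith
  have hZγ : 2208 / γ ≤ Z := by
    have := abs_nonneg (Real.log δ)
    linarith
  have hZδ : -Real.log δ ≤ Z := by
    have := neg_le_abs (Real.log δ)
    linarith
  refine ⟨⌈Z ^ 32⌉₊, fun n hn _ ℓ hℓ => ?_⟩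
  obtain ⟨z, hzZ, hz⟩ := exists_root (n := n) (Z := Z) (m := 32) (by linarith) (by norm_num)
    (Nat.ceil_le.1 hn)
  have hz4 : 4 ≤ z := hZ4.trans hzZ
  have hz0 : 0 < z := by linarith
  have hnℓ : (n : ℝ) ≤ ℓ := by exact_mod_cast hℓ
  have hn0 : (0 : ℝ) < n := by rw [← hz]; positivity
  have hℓ0 : (0 : ℝ) < ℓ := hn0.trans_le hnℓ
  by_cases hcase : (ℓ : ℝ) ≤ z ^ 36
  · set s := ⌈z ^ 30⌉₊ with hs
    set t := ⌈z ^ 16⌉₊ with ht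
    have hs1 : z ^ 30 ≤ s := Nat.le_ceil _
    have ht1 : z ^ 16 ≤ t := Nat.le_ceil _
    have h16 : 1 ≤ z ^ 16 := one_le_pow₀ (by linarith)
    have h30 : 1 ≤ z ^ 30 := one_le_pow₀ (by linarith)
    have hs2 : (s : ℝ) ≤ 2 * z ^ 30 := by
      have := Nat.ceil_lt_add_one (a := z ^ 30) (by positivity)
      linarith
    have ht2 : (t : ℝ) ≤ 2 * z ^ 16 := by
      have := Nat.ceil_lt_add_one (a := z ^ 16) (by positivity)
      linarith
    have hts : t ≤ s := Nat.ceil_mono (pow_le_pow_right₀ (by linarith) (by norm_num))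
    have hs0 : 1 ≤ s := by exact_mod_cast h30.trans hs1
    refine ⟨_, (card_exists_not_starAdj_le hℓ (t := t) hs0).trans ?_, fun σ hσ => ?_⟩
    · gcongr
      have h2 : (2 : ℝ) ^ (3 * n ^ 2) ≤ Real.exp (3 * (n : ℝ) ^ 2) := by
        have : (2 : ℝ) ≤ Real.exp 1 := by linarith [Real.add_one_le_exp (1 : ℝ)]
        calc (2 : ℝ) ^ (3 * n ^ 2) ≤ Real.exp 1 ^ (3 * n ^ 2) := by gcongr
          _ = _ := by
            rw [← Real.exp_nat_mul]
            push_cast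
            rw [mul_one]
      calc _ ≤ Real.exp (3 * (n : ℝ) ^ 2) *
            Real.exp (-(((t : ℝ) * (s * (s * (s - 1))) - (t : ℝ) ^ 2 * (n : ℝ) ^ 2) / ℓ) / 2) := by
            gcongr
        _ ≤ Real.exp (-z) := by
            rw [← Real.exp_add]
            exact Real.exp_le_exp.2 (two_pow_mul_exp_le hz4 hz hℓ0 hcase hs1 ht1 ht2)
        _ ≤ Real.exp (Real.log δ) := Real.exp_le_exp.2 (by linarith)
        _ = δ := Real.exp_log hδ
    · have hσ : ∀ (T : Finset (Fin n)) (R U : Fin n → Finset (Fin n)), T.card = t →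
          (∀ a, 0 ∉ U a) → (∀ a ∈ T, a ∉ R a ∧ s ≤ (R a).card ∧ s ≤ (U a).card ∧
            ∀ b ∈ R a, s ≤ (U b).card) →
          ∃ a ∈ T, ∃ b ∈ R a, ∃ j ∈ U a, ∃ k ∈ U b, StarAdj hℓ σ (j, a) (k, b) := by
        by_contra h
        exact hσ (Finset.mem_filter.2 ⟨Finset.mem_univ _, h⟩)
      obtain ⟨c, hc, hlt⟩ := exists_assignment_card_lt (starAdj_symm hℓ σ) hts hσ
      refine ⟨c, hc, fun k hk => ?_⟩
      have hlt' : ((unmatchedPairs (StarAdj hℓ σ) c).card : ℝ) ≤ 4 * s * n := by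
        exact_mod_cast hlt.le
      have hk' : (k : ℝ) ≤ 138 * z := by
        have h1 : 2 * (n * ℓ : ℝ) ≤ z ^ 69 := by
          calc 2 * (n * ℓ : ℝ) ≤ z * (z ^ 32 * z ^ 36) := by
                rw [hz]
                gcongr
                linarith
            _ = z ^ 69 := by ring
        have h2 := natCast_le_two_mul_log (hk.trans h1)
        rw [Real.log_pow] at h2
        have h3 := Real.log_le_self hz0.le
        push_cast at h2
        linarith
      have hγz : 2208 ≤ γ * z := by
        have := (div_le_iff₀ hγ).1 (hZγ.trans hzZ)
        linarith
      calc 2 * k * ((unmatchedPairs (StarAdj hℓ σ) c).card : ℝ)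
          ≤ 2 * (138 * z) * (4 * (2 * z ^ 30) * n) := by
            gcongr
            exact hlt'.trans (by gcongr)
        _ = 2208 * (z ^ 31 * z ^ 32) := by rw [← hz]; ring
        _ ≤ γ * z * (z ^ 31 * z ^ 32) := by gcongr
        _ = γ * (z ^ 32 * z ^ 32) := by ring
        _ ≤ γ * (n * ℓ) := by rw [hz]; gcongr
  · push Not at hcase
    refine ⟨∅, by simp; positivity, fun σ _ => ?_⟩
    refine ⟨fun a => Equiv.swap a 0, fun a => by simp, fun k hk => ?_⟩
    obtain ⟨v, hvz, hv⟩ := exists_root (n := ℓ) (Z := z) (m := 36) hz0.le (by norm_num) hcase.le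
    have hv4 : 4 ≤ v := hz4.trans hvz
    have hv0 : 0 < v := by linarith
    have hcard : ((unmatchedPairs (StarAdj hℓ σ) fun a => Equiv.swap a 0).card : ℝ) ≤ n * n := by
      rw [← sq]
      exact_mod_cast card_unmatchedPairs_le
    have hk' : (k : ℝ) ≤ 216 * v := by
      have h1 : 2 * (n * ℓ : ℝ) ≤ v ^ 73 := by
        calc 2 * (n * ℓ : ℝ) ≤ v * (v ^ 36 * v ^ 36) := by
              rw [hv]
              gcongr
              linarith
          _ = v ^ 73 := by ring
      have h2 := natCast_le_two_mul_log (hk.trans h1)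
      rw [Real.log_pow] at h2
      have h3 := Real.log_le_self hv0.le
      push_cast at h2
      linarith
    have hγv : 432 ≤ γ * v := by
      have := (div_le_iff₀ hγ).1 (hZγ.trans (hzZ.trans hvz))
      linarith
    have hnv : (n : ℝ) ≤ v ^ 32 := by
      rw [← hz]
      gcongr
    calc 2 * k * ((unmatchedPairs (StarAdj hℓ σ) fun a => Equiv.swap a 0).card : ℝ)
        ≤ 2 * (216 * v) * (n * v ^ 32) := by
          gcongr
          exact hcard.trans (by gcongr)
      _ = 432 * (n * v ^ 33) := by ring
      _ ≤ γ * v * (n * v ^ 33) := by gcongr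
      _ = γ * (n * v ^ 34) := by ring
      _ ≤ γ * (n * v ^ 36) := by
          gcongr
          · linarith
          · norm_num
      _ = γ * (n * ℓ) := by rw [hv]

/-! ### Expansion with high probability -/

section ExpansionBound

lemma choose_le_exp_mul_div_pow (N : ℕ) {r : ℕ} (hr : 1 ≤ r) :
    (N.choose r : ℝ) ≤ (Real.exp 1 * (N / r)) ^ r := by
  have hr0 : (0 : ℝ) < r := by exact_mod_cast hr
  have h1 := Nat.choose_le_pow_div (α := ℝ) r N
  have h2 := Real.pow_div_factorial_le_exp (r : ℝ) hr0.le r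
  calc (N.choose r : ℝ) ≤ (N : ℝ) ^ r / (Nat.factorial r : ℝ) := h1
    _ = (N / r : ℝ) ^ r * ((r : ℝ) ^ r / (Nat.factorial r : ℝ)) := by
        rw [div_pow]
        field_simp
    _ ≤ (N / r : ℝ) ^ r * Real.exp r := by gcongr
    _ = _ := by rw [mul_pow, ← Real.exp_nat_mul, mul_one, mul_comm]

lemma choose_mul_choose_le (N : ℕ) {x : ℕ} (hx : 1 ≤ x) :
    (N.choose x * N.choose (2 * x) : ℝ) ≤ ((Real.exp 1 * (N / x)) ^ 3) ^ x := by
  have hx0 : (0 : ℝ) < x := by exact_mod_cast hx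
  have h1 := choose_le_exp_mul_div_pow N hx
  have h2 := choose_le_exp_mul_div_pow N (by omega : 1 ≤ 2 * x)
  calc (N.choose x * N.choose (2 * x) : ℝ)
      ≤ (Real.exp 1 * (N / x)) ^ x * (Real.exp 1 * (N / (2 * x : ℕ))) ^ (2 * x) := by gcongr
    _ ≤ (Real.exp 1 * (N / x)) ^ x * (Real.exp 1 * (N / x)) ^ (2 * x) := by
        gcongr
        omega
    _ = _ := by ring

lemma choose_mul_choose_mul_exp_le {n ℓ x : ℕ} (hn : 12 ≤ n) (hℓ : 1 ≤ ℓ) (hx : 1 ≤ x) {y₀ y : ℝ}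
    (hy : y₀ ≤ y) (hxy : Real.exp (-y) = 8 * (x : ℝ) / (n * ℓ) + n / ℓ) :
    ((n * ℓ).choose x * (n * ℓ).choose (2 * x) * Real.exp (-(x * (n / 2) * y) / 2) : ℝ) ≤
      (Real.exp 3 * (8 + n ^ 2) ^ 3 * Real.exp (-((n / 4 - 3) * y₀))) ^ x := by
  have hn12 : (12 : ℝ) ≤ n := by exact_mod_cast hn
  have hn0 : (0 : ℝ) < n := by linarith
  have hℓ0 : (0 : ℝ) < ℓ := by exact_mod_cast hℓ
  have hx1 : (1 : ℝ) ≤ x := by exact_mod_cast hx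
  have hq : (n * ℓ : ℝ) / x ≤ (8 + n ^ 2) * Real.exp y := by
    have h1 : Real.exp (-y) ≤ (8 + n ^ 2) * (x / (n * ℓ)) := by
      have : (n / ℓ : ℝ) ≤ n ^ 2 * (x / (n * ℓ)) := by
        calc (n / ℓ : ℝ) ≤ n / ℓ * x := le_mul_of_one_le_right (by positivity) hx1
          _ = _ := by field_simp
      rw [hxy, add_mul, mul_div_assoc]
      linarith
    calc (n * ℓ : ℝ) / x = Real.exp (-y) * Real.exp y * (n * ℓ / x) := by
          rw [← Real.exp_add]
          simp
      _ ≤ (8 + n ^ 2) * (x / (n * ℓ)) * Real.exp y * (n * ℓ / x) := by gcongr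
      _ = _ := by field_simp
  have hmono : (n / 4 - 3) * y₀ ≤ (n / 4 - 3 : ℝ) * y := by
    have : (0 : ℝ) ≤ n / 4 - 3 := by linarith
    gcongr
  calc ((n * ℓ).choose x * (n * ℓ).choose (2 * x) * Real.exp (-(x * (n / 2) * y) / 2) : ℝ)
      ≤ ((Real.exp 1 * ((n * ℓ : ℕ) / x)) ^ 3) ^ x * Real.exp (-(n / 4 * y)) ^ x := by
        refine mul_le_mul (choose_mul_choose_le _ hx) (le_of_eq ?_) (Real.exp_pos _).le
          (by positivity)
        rw [← Real.exp_nat_mul]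
        ring_nf
    _ = ((Real.exp 1 * (n * ℓ / x)) ^ 3 * Real.exp (-(n / 4 * y))) ^ x := by
        rw [Nat.cast_mul, ← mul_pow]
    _ ≤ ((Real.exp 1 * ((8 + n ^ 2) * Real.exp y)) ^ 3 * Real.exp (-(n / 4 * y))) ^ x := by
        gcongr
    _ = (Real.exp 3 * (8 + n ^ 2) ^ 3 * Real.exp (-((n / 4 - 3) * y))) ^ x := by
        congr 1
        rw [mul_pow, mul_pow, ← Real.exp_nat_mul, ← Real.exp_nat_mul,
          show -((n / 4 - 3 : ℝ) * y) = (3 : ℕ) * y + -(n / 4 * y) by push_cast; ring, Real.exp_add]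
        norm_num
        ring
    _ ≤ _ := by gcongr

lemma sum_Icc_one_pow_le {r : ℝ} (hr : 0 ≤ r) (hr2 : r ≤ 1 / 2) (m : ℕ) :
    ∑ x ∈ Finset.Icc 1 m, r ^ x ≤ 2 * r := by
  have h : ∑ x ∈ Finset.range m, r ^ x ≤ 2 := by
    have h1 := mul_neg_geom_sum r m
    have h2 : 0 ≤ ∑ x ∈ Finset.range m, r ^ x := Finset.sum_nonneg fun _ _ => by positivity
    have h3 : 0 ≤ r ^ m := by positivity
    nlinarith
  rw [Finset.range_eq_Ico] at h
  calc ∑ x ∈ Finset.Icc 1 m, r ^ x = r * ∑ x ∈ Finset.Ico 0 m, r ^ x := by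
        rw [Finset.mul_sum, ← Finset.Ico_add_one_right_eq_Icc, Finset.sum_Ico_eq_sum_range,
          Finset.sum_Ico_eq_sum_range]
        exact Finset.sum_congr (by simp) fun i _ => by ring
    _ ≤ 2 * r := by nlinarith

open scoped Classical in
lemma card_not_expanding_le {n ℓ : ℕ} [NeZero n] (hℓ : n ≤ ℓ) (hn : 12 ≤ n) {M : ℕ}
    (hM : 4 * M ≤ n * ℓ) {y₀ : ℝ} (hy₀ : 0 ≤ y₀)
    (hMy : 16 * (M : ℝ) / (n * ℓ) + n / ℓ ≤ Real.exp (-y₀)) {r : ℝ}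
    (hr : Real.exp 3 * (8 + (n : ℝ) ^ 2) ^ 3 * Real.exp (-((n / 4 - 3) * y₀)) ≤ r)
    (hr2 : r ≤ 1 / 2) :
    ((Finset.univ.filter fun σ : Fin n → Fin n → Equiv.Perm (Fin ℓ) =>
      ¬ ∀ U : Finset (Fin n × Fin ℓ), (∀ x ∈ U, x.1 ≠ 0) → U.card ≤ 2 * M →
        2 * U.card ≤ (nbhd (liftGraph n ℓ σ) U (freeVertices hℓ σ)).card).card : ℝ) ≤
      2 * r * Fintype.card (Fin n → Fin n → Equiv.Perm (Fin ℓ)) := by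
  have hn0 : (0 : ℝ) < n := by exact_mod_cast (by omega : 0 < n)
  have hℓ0 : (0 : ℝ) < ℓ := by exact_mod_cast (by omega : 0 < ℓ)
  have hr0 : 0 ≤ r := le_trans (by positivity) hr
  set E : ℕ → Finset (Fin n → Fin n → Equiv.Perm (Fin ℓ)) := fun x =>
    Finset.univ.filter fun σ => ∃ U : Finset (Fin n × Fin ℓ), (∀ v ∈ U, v.1 ≠ 0) ∧ U.card = x ∧
      (nbhd (liftGraph n ℓ σ) U (freeVertices hℓ σ)).card < 2 * x with hE
  have hsub : (Finset.univ.filter fun σ : Fin n → Fin n → Equiv.Perm (Fin ℓ) =>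
      ¬ ∀ U : Finset (Fin n × Fin ℓ), (∀ x ∈ U, x.1 ≠ 0) → U.card ≤ 2 * M →
        2 * U.card ≤ (nbhd (liftGraph n ℓ σ) U (freeVertices hℓ σ)).card) ⊆
      (Finset.Icc 1 (2 * M)).biUnion E := by
    intro σ hσ
    have hσ := (Finset.mem_filter.1 hσ).2
    push Not at hσ
    obtain ⟨U, hU0, hUM, hU⟩ := hσ
    exact Finset.mem_biUnion.2 ⟨U.card, Finset.mem_Icc.2 ⟨by omega, hUM⟩,
      Finset.mem_filter.2 ⟨Finset.mem_univ _, U, hU0, rfl, hU⟩⟩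
  have hterm : ∀ x ∈ Finset.Icc 1 (2 * M), ((E x).card : ℝ) ≤
      r ^ x * Fintype.card (Fin n → Fin n → Equiv.Perm (Fin ℓ)) := by
    intro x hx
    obtain ⟨hx1, hxM⟩ := Finset.mem_Icc.1 hx
    have hx1' : (1 : ℝ) ≤ x := by exact_mod_cast hx1
    have hxM' : (x : ℝ) ≤ 2 * M := by exact_mod_cast hxM
    set w : ℝ := 8 * (x : ℝ) / (n * ℓ) + n / ℓ with hw
    have hw0 : 0 < w := by positivity
    have hwy : w ≤ Real.exp (-y₀) := by
      refine le_trans ?_ hMy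
      rw [hw]
      have : 8 * (x : ℝ) ≤ 16 * M := by linarith
      gcongr
    have hy : y₀ ≤ -Real.log w := by
      have := Real.log_le_log hw0 hwy
      rw [Real.log_exp] at this
      linarith
    have hexp : Real.exp (- -Real.log w) = w := by rw [neg_neg, Real.exp_log hw0]
    refine (card_exists_nbhd_lt_of_card_eq hℓ hx1 (by omega) (by omega) (hy₀.trans hy)
      hexp.ge).trans ?_
    gcongr
    exact (choose_mul_choose_mul_exp_le hn (by omega) hx1 hy hexp).trans (by gcongr)
  calc _ ≤ (((Finset.Icc 1 (2 * M)).biUnion E).card : ℝ) := by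
        exact_mod_cast Finset.card_le_card hsub
    _ ≤ ∑ x ∈ Finset.Icc 1 (2 * M), ((E x).card : ℝ) := by exact_mod_cast Finset.card_biUnion_le
    _ ≤ ∑ x ∈ Finset.Icc 1 (2 * M), r ^ x * Fintype.card (Fin n → Fin n → Equiv.Perm (Fin ℓ)) :=
        Finset.sum_le_sum hterm
    _ ≤ _ := by
        rw [← Finset.sum_mul]
        gcongr
        exact sum_Icc_one_pow_le hr0 hr2 _

lemma tendsto_exp_three_mul_pow_mul_exp_neg {y₀ : ℝ} (hy₀ : 0 < y₀) :
    Filter.Tendsto (fun n : ℕ =>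
      Real.exp 3 * (8 + (n : ℝ) ^ 2) ^ 3 * Real.exp (-((n / 4 - 3) * y₀))) Filter.atTop
      (nhds 0) := by
  have h (k : ℕ) : Filter.Tendsto (fun n : ℕ => (n : ℝ) ^ k * Real.exp (-(y₀ / 4) * n))
      Filter.atTop (nhds 0) := by
    have h1 := (Real.tendsto_pow_mul_exp_neg_atTop_nhds_zero k).comp
      (tendsto_natCast_atTop_atTop.const_mul_atTop (by positivity : 0 < y₀ / 4))
    have h2 := h1.const_mul ((y₀ / 4) ^ k)⁻¹
    rw [mul_zero] at h2
    refine h2.congr fun n => ?_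
    simp only [Function.comp_apply]
    rw [mul_pow, neg_mul]
    field_simp
  have h0 := ((((h 0).const_mul 512).add ((h 2).const_mul 192)).add
    (((h 4).const_mul 24).add (h 6))).const_mul (Real.exp 3 * Real.exp (3 * y₀))
  simp only [mul_zero, add_zero] at h0
  refine h0.congr fun n => ?_
  rw [show -((n / 4 - 3 : ℝ) * y₀) = 3 * y₀ + -(y₀ / 4) * n by ring, Real.exp_add]
  ring

end ExpansionBound

/-! ### The Hajós number of a random lift -/

section RandomLiftHajos

lemma le_card_freeVertices {n ℓ : ℕ} [NeZero n] (hℓ : n ≤ ℓ)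
    (σ : Fin n → Fin n → Equiv.Perm (Fin ℓ)) :
    n * ℓ ≤ (freeVertices hℓ σ).card + (ℓ + n * n) := by
  classical
  have hsub : (Finset.univ : Finset (Fin n × Fin ℓ)) ⊆ freeVertices hℓ σ ∪
      (({0} ×ˢ Finset.univ) ∪
        (Finset.univ : Finset (Fin n × Fin n)).image fun x => (x.1, starPos hℓ σ x.1 x.2)) := by
    rintro ⟨j, b⟩ -
    by_cases hj : j = 0
    · simp [hj]
    · by_cases hb : ∃ a, b = starPos hℓ σ j a
      · obtain ⟨a, rfl⟩ := hb
        exact Finset.mem_union_right _ (Finset.mem_union_right _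
          (Finset.mem_image.2 ⟨(j, a), Finset.mem_univ _, rfl⟩))
      · push Not at hb
        exact Finset.mem_union_left _ (Finset.mem_filter.2 ⟨Finset.mem_univ _, hj, hb⟩)
  have h1 := (Finset.card_le_card hsub).trans (Finset.card_union_le _ _)
  have h2 := Finset.card_union_le (({0} : Finset (Fin n)) ×ˢ (Finset.univ : Finset (Fin ℓ)))
    ((Finset.univ : Finset (Fin n × Fin n)).image fun x => (x.1, starPos hℓ σ x.1 x.2))
  have h3 := Finset.card_image_le (s := (Finset.univ : Finset (Fin n × Fin n)))
    (f := fun x => (x.1, starPos hℓ σ x.1 x.2))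
  simp only [Finset.card_univ, Fintype.card_prod, Fintype.card_fin, Finset.card_product,
    Finset.card_singleton, one_mul] at h1 h2 h3
  omega

lemma four_pow_mul_exp_le {n ℓ : ℕ} {α M : ℝ} (hℓ : 1 ≤ ℓ) (hα : 0 < α) (hM : α * (n * ℓ) ≤ M)
    (hn : 1 ≤ α * n) (hαn : 6 ≤ α * (α * n - 1)) :
    (4 : ℝ) ^ (n * ℓ) * Real.exp (-((M ^ 2 - ℓ * M) / ℓ) / 2) ≤ Real.exp (-n) := by
  have hℓ1 : (1 : ℝ) ≤ ℓ := by exact_mod_cast hℓ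
  have hn0 : (0 : ℝ) ≤ n := Nat.cast_nonneg n
  have h4 : (4 : ℝ) ^ (n * ℓ) ≤ Real.exp (2 * (n * ℓ)) := by
    have h2 : (4 : ℝ) ≤ Real.exp 2 := by
      have h := Real.add_one_le_exp (1 : ℝ)
      rw [show (2 : ℝ) = 1 + 1 by norm_num, Real.exp_add]
      nlinarith
    calc (4 : ℝ) ^ (n * ℓ) ≤ Real.exp 2 ^ (n * ℓ) := by gcongr
      _ = _ := by
        rw [← Real.exp_nat_mul]
        push_cast
        ring_nf
  have hM2 : 6 * (n * ℓ) ≤ (M ^ 2 - ℓ * M) / ℓ := by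
    rw [le_div_iff₀ (by linarith)]
    have hα1 : (0 : ℝ) ≤ α * n - 1 := by linarith
    calc (6 * (n * ℓ) : ℝ) * ℓ ≤ α * (α * n - 1) * (n * ℓ) * ℓ := by gcongr
      _ = α * (n * ℓ) * (α * (n * ℓ) - ℓ) := by ring
      _ ≤ M * (M - ℓ) := by
        have h0 : 0 ≤ α * (n * ℓ) - ℓ := by nlinarith
        have : 0 ≤ α * (n * ℓ) := by positivity
        gcongr
        linarith
      _ = M ^ 2 - ℓ * M := by ring
  have hnℓ : (n : ℝ) ≤ n * ℓ := le_mul_of_one_le_right hn0 hℓ1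
  calc _ ≤ Real.exp (2 * (n * ℓ)) * Real.exp (-((M ^ 2 - ℓ * M) / ℓ) / 2) := by gcongr
    _ ≤ Real.exp (-n) := by
      rw [← Real.exp_add]
      exact Real.exp_le_exp.2 (by linarith)

lemma hasTopClique_of_card_unmatchedPairs_le {n ℓ : ℕ} [NeZero n] {hℓ : n ≤ ℓ}
    {σ : Fin n → Fin n → Equiv.Perm (Fin ℓ)} {γ : ℝ} {M : ℕ} (hM : 2 ≤ M)
    (hMγ : 32 * (M : ℝ) ≤ γ * (n * ℓ)) (hγn : 1 ≤ γ * n)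
    (hnℓ : (n : ℝ) ≤ (1 - 2 * γ) * ℓ)
    {c : Fin n → Equiv.Perm (Fin n)} (hc : ∀ a, c a a = 0)
    (hck : ∀ k : ℕ, (2 : ℝ) ^ k ≤ 2 * (n * ℓ) →
      2 * k * ((unmatchedPairs (StarAdj hℓ σ) c).card : ℝ) ≤ γ / 2 * (n * ℓ))
    (hjoin : ∀ B C : Finset (Fin n × Fin ℓ), (∀ x ∈ B, x.1 ≠ 0) → (∀ x ∈ C, x.1 ≠ 0) →
      M ≤ B.card → M ≤ C.card → ∃ x ∈ B, ∃ y ∈ C, (liftGraph n ℓ σ).Adj x y)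
    (hexp : ∀ U : Finset (Fin n × Fin ℓ), (∀ x ∈ U, x.1 ≠ 0) → U.card ≤ 2 * M →
      2 * U.card ≤ (nbhd (liftGraph n ℓ σ) U (freeVertices hℓ σ)).card) :
    HasTopClique (liftGraph n ℓ σ) n := by
  have hk := Nat.clog_pos one_lt_two hM
  have hpow : 2 ^ Nat.clog 2 M ≤ 2 * M := by
    have h := Nat.pow_pred_clog_lt_self one_lt_two (by omega : 1 < M)
    obtain ⟨k, hk'⟩ := Nat.exists_eq_succ_of_ne_zero hk.ne'
    rw [hk'] at h ⊢
    simp only [Nat.succ_eq_add_one, Nat.pred_eq_sub_one, Nat.add_sub_cancel] at h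
    rw [pow_succ]
    omega
  have hpow' : (2 : ℝ) ^ Nat.clog 2 M ≤ 2 * M := by exact_mod_cast hpow
  have hnℓ0 : (0 : ℝ) ≤ n * ℓ := by positivity
  have hk2 := hck (Nat.clog 2 M) (by nlinarith)
  refine hasTopClique_of_expanding (by omega) hk (Nat.le_pow_clog one_lt_two M) hc hjoin hexp ?_
  have hfree : (n * ℓ : ℝ) ≤ (freeVertices hℓ σ).card + (ℓ + n * n) := by
    exact_mod_cast le_card_freeVertices hℓ σ
  have hℓn : (ℓ : ℝ) ≤ γ * n * ℓ := le_mul_of_one_le_left (Nat.cast_nonneg ℓ) hγn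
  have hnn : (n : ℝ) * n ≤ n * ((1 - 2 * γ) * ℓ) := by gcongr
  have : 2 * (Nat.clog 2 M : ℝ) * (unmatchedPairs (StarAdj hℓ σ) c).card +
      (5 * M + 4 * 2 ^ Nat.clog 2 M) ≤ (freeVertices hℓ σ).card := by nlinarith
  exact_mod_cast this

lemma one_sub_le_liftProb {n ℓ : ℕ} {δ : ℝ} {p : SimpleGraph (Fin n × Fin ℓ) → Prop}
    {S : Finset (Fin n → Fin n → Equiv.Perm (Fin ℓ))}
    (hS : (S.card : ℝ) ≤ δ * Fintype.card (Fin n → Fin n → Equiv.Perm (Fin ℓ)))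
    (h : ∀ σ ∉ S, p (liftGraph n ℓ σ)) : 1 - δ ≤ liftProb n ℓ p := by
  classical
  have hpos : (0 : ℝ) < Fintype.card (Fin n → Fin n → Equiv.Perm (Fin ℓ)) := by
    exact_mod_cast Fintype.card_pos
  rw [liftProb, le_div_iff₀ hpos]
  have hcard : (Fintype.card (Fin n → Fin n → Equiv.Perm (Fin ℓ)) : ℝ) = S.card + Sᶜ.card := by
    exact_mod_cast (Finset.card_add_card_compl S).symm
  have hle : (Sᶜ.card : ℝ) ≤
      (@Finset.filter _ (fun σ : Fin n → Fin n → Equiv.Perm (Fin ℓ) => p (liftGraph n ℓ σ))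
        (Classical.decPred _) Finset.univ).card := by
    refine Nat.cast_le.2 (Finset.card_le_card fun σ hσ => ?_)
    rw [Finset.mem_filter]
    exact ⟨Finset.mem_univ _, h σ (Finset.mem_compl.1 hσ)⟩
  linarith

end RandomLiftHajos

/-- For every `ε, δ > 0` there exists `N` such that for all `n ≥ N` and all integers
`ℓ ≥ (1+ε)n`, the proportion of `ℓ`-lifts of `K_n` whose Hajós number equals exactly `n`
is at least `1 - δ`. -/
theorem stmt1 (ε δ : ℝ) (hε : 0 < ε) (hδ : 0 < δ) :
    ∃ N : ℕ, ∀ n : ℕ, N ≤ n → ∀ ℓ : ℕ, (1 + ε) * n ≤ (ℓ : ℝ) →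
      1 - δ ≤ liftProb n ℓ (fun G => hajosNumber G = n) := by
  classical
  set γ : ℝ := ε / (2 * (1 + ε)) with hγ
  have hγ0 : 0 < γ := by positivity
  have hγ2 : (1 - 2 * γ) * (1 + ε) = 1 := by
    rw [hγ]
    field_simp
    ring
  have hγ1 : 2 * γ < 1 := by nlinarith
  set y₀ : ℝ := -Real.log (1 - γ) with hy₀
  have hy₀0 : 0 < y₀ := neg_pos.2 (Real.log_neg (by linarith) (by linarith))
  have hexpy : Real.exp (-y₀) = 1 - γ := by rw [hy₀, neg_neg, Real.exp_log (by linarith)]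
  obtain ⟨N₁, hN₁⟩ := exists_card_unmatchedPairs_le (half_pos hγ0)
    (by positivity : 0 < δ / 3)
  have hr := (tendsto_exp_three_mul_pow_mul_exp_neg hy₀0).eventually_le_const
    (lt_min (by norm_num : (0 : ℝ) < 1 / 2) (by positivity : 0 < δ / 6))
  have hexpn := (Real.tendsto_exp_neg_atTop_nhds_zero.comp
    tendsto_natCast_atTop_atTop).eventually_le_const (by positivity : 0 < δ / 3)
  have hα := tendsto_natCast_atTop_atTop.eventually_ge_atTop (512 * (1 + 64 / γ) / γ)
  obtain ⟨N₂, hN₂⟩ := Filter.eventually_atTop.1 (hr.and (hexpn.and hα))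
  refine ⟨N₁ + N₂ + 12, fun n hn ℓ hℓ => ?_⟩
  obtain ⟨hr, hexpn, hα⟩ := hN₂ n (by omega)
  have : NeZero n := ⟨by omega⟩
  have hn0 : (0 : ℝ) < n := by exact_mod_cast (by omega : 0 < n)
  have hnℓ' : (n : ℝ) ≤ ℓ := by nlinarith
  have hnℓ : n ≤ ℓ := by exact_mod_cast hnℓ'
  have hℓ1 : 1 ≤ ℓ := by omega
  have hℓ1' : (1 : ℝ) ≤ ℓ := by exact_mod_cast hℓ1
  have hγn : 512 * (1 + 64 / γ) ≤ γ * n := by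
    have := (div_le_iff₀ hγ0).1 hα
    linarith
  have h64 : 0 < 64 / γ := by positivity
  have hnℓγ : (n : ℝ) ≤ (1 - 2 * γ) * ℓ := by
    calc (n : ℝ) = (1 - 2 * γ) * (1 + ε) * n := by rw [hγ2, one_mul]
      _ = (1 - 2 * γ) * ((1 + ε) * n) := by ring
      _ ≤ _ := mul_le_mul_of_nonneg_left hℓ (by linarith)
  have hγnℓ : 512 ≤ γ * (n * ℓ) := by
    calc (512 : ℝ) ≤ γ * n * 1 := by linarith
      _ ≤ γ * n * ℓ := by gcongr
      _ = _ := by ring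
  set M := ⌈γ / 64 * (n * ℓ)⌉₊ with hMdef
  have hM1 : γ / 64 * (n * ℓ) ≤ M := Nat.le_ceil _
  have hM2 : 32 * (M : ℝ) ≤ γ * (n * ℓ) := by
    have := Nat.ceil_lt_add_one (a := γ / 64 * (n * ℓ)) (by positivity)
    linarith
  have hM3 : 2 ≤ M := by
    have : (2 : ℝ) ≤ M := by linarith
    exact_mod_cast this
  obtain ⟨S₁, hS₁, hS₁'⟩ := hN₁ n (by omega) ℓ hnℓ
  have hS₂ := card_exists_not_adj_le (n := n) M hℓ1
  have hS₃ := card_not_expanding_le hnℓ (by omega) (M := M) (by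
    have : 4 * (M : ℝ) ≤ n * ℓ := by nlinarith
    exact_mod_cast this) hy₀0.le (by
    rw [hexpy]
    have h1 : 16 * (M : ℝ) / (n * ℓ) ≤ γ / 2 := by
      rw [div_le_iff₀ (by positivity)]
      linarith
    have h2 : (n / ℓ : ℝ) ≤ 1 - 2 * γ := by rwa [div_le_iff₀ (by linarith)]
    linarith) hr (min_le_left _ _)
  set S₂ := Finset.univ.filter fun σ : Fin n → Fin n → Equiv.Perm (Fin ℓ) =>
    ¬ ∀ B C : Finset (Fin n × Fin ℓ), (∀ x ∈ B, x.1 ≠ 0) → (∀ x ∈ C, x.1 ≠ 0) →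
      M ≤ B.card → M ≤ C.card → ∃ x ∈ B, ∃ y ∈ C, (liftGraph n ℓ σ).Adj x y with hS₂def
  set S₃ := Finset.univ.filter fun σ : Fin n → Fin n → Equiv.Perm (Fin ℓ) =>
    ¬ ∀ U : Finset (Fin n × Fin ℓ), (∀ x ∈ U, x.1 ≠ 0) → U.card ≤ 2 * M →
      2 * U.card ≤ (nbhd (liftGraph n ℓ σ) U (freeVertices hnℓ σ)).card with hS₃def
  have hcard₂ : (S₂.card : ℝ) ≤ δ / 3 * Fintype.card (Fin n → Fin n → Equiv.Perm (Fin ℓ)) := by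
    refine le_trans (le_trans (le_of_eq ?_) hS₂) ?_
    · congr!
    · gcongr
      refine (four_pow_mul_exp_le hℓ1 (by positivity) hM1 (by linarith) ?_).trans hexpn
      have h1 : 6 * (64 / γ) ≤ γ / 64 * n - 1 := by linarith
      have h2 : γ / 64 * (64 / γ) = 1 := by field_simp
      have h3 := mul_le_mul_of_nonneg_left h1 (by positivity : 0 ≤ γ / 64)
      linarith
  have hcard₃ : (S₃.card : ℝ) ≤ δ / 3 * Fintype.card (Fin n → Fin n → Equiv.Perm (Fin ℓ)) := by
    refine le_trans (le_trans (le_of_eq ?_) hS₃) ?_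
    · congr!
    · gcongr
      linarith [min_le_right (1 / 2 : ℝ) (δ / 6)]
  have hcard : ((S₁ ∪ (S₂ ∪ S₃)).card : ℝ) ≤ S₁.card + (S₂.card + S₃.card) := by
    exact_mod_cast (Finset.card_union_le _ _).trans
      (Nat.add_le_add_left (Finset.card_union_le _ _) _)
  refine one_sub_le_liftProb (S := S₁ ∪ (S₂ ∪ S₃)) (by linarith) fun σ hσ => ?_
  simp only [Finset.mem_union, not_or] at hσ
  obtain ⟨hσ₁, hσ₂, hσ₃⟩ := hσ
  rw [hS₂def, Finset.mem_filter] at hσ₂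
  rw [hS₃def, Finset.mem_filter] at hσ₃
  have hjoin := not_not.1 fun h => hσ₂ ⟨Finset.mem_univ _, h⟩
  have hexp := not_not.1 fun h => hσ₃ ⟨Finset.mem_univ _, h⟩
  obtain ⟨c, hc, hck⟩ := hS₁' σ hσ₁
  exact hajosNumber_liftGraph_eq (by omega) (hasTopClique_of_card_unmatchedPairs_le hM3 hM2
    (by linarith) hnℓγ hc hck hjoin hexp)
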